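/- arXiv:1810.12263 — 3 statements merged into one kernel-verified Lean document; each statement's English description precedes it below -/
import Mathlib

section
/- (PAC-Bayesian bound with countably many priors.) Let H be a measurable hypothesis space, ℓ : Y×Y → [0,1] a measurable loss, μ a probability measure on X×Y, N a positive natural number, Θ a countable set, p_θ a probability distribution on Θ, {P^θ}_{θ∈Θ} a family of probability measures on H, and δ ∈ (0,1]. With R_S(Q) and R(Q) the empirical and true Gibbs risks of a probability measure Q on H, the following holds with probability at least 1−δ over the training set S drawn i.i.d. from μ^N: for every θ ∈ Θ and every probability measure Q on H, R(Q) ≤ kl⁻¹( R_S(Q), (KL(Q‖P^θ) + ln(1/p_θ) + ln(2√N/δ)) / N ). -/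
open MeasureTheory ENNReal NNReal
open scoped Classical

/-- Kullback–Leibler divergence: `KL(Q‖P) = ∫ ln(dQ/dP) dQ` if `Q ≪ P` (with value `+∞` if the
integral diverges), and `+∞` otherwise. -/
noncomputable def klDiv {α : Type*} [MeasurableSpace α] (Q P : Measure α) : ℝ≥0∞ :=
  if Q ≪ P ∧ Integrable (llr Q P) Q then ENNReal.ofReal (∫ x, llr Q P x ∂Q) else ⊤

/-- Binary KL divergence `kl(q‖p)`, with the conventions `0 · ln 0 = 0` and
`kl(q‖p) = +∞` when `p ∈ {0,1}` and `q ≠ p`. -/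
noncomputable def bkl (q p : ℝ) : ℝ≥0∞ :=
  if q = p then 0
  else if p = 0 ∨ p = 1 then ⊤
  else ENNReal.ofReal (q * Real.log (q / p) + (1 - q) * Real.log ((1 - q) / (1 - p)))

/-- Inverse binary KL divergence `kl⁻¹(q,ε) = max{p ∈ [0,1] : kl(q‖p) ≤ ε}`. -/
noncomputable def klInv (q : ℝ) (ε : ℝ≥0∞) : ℝ :=
  sSup {p | p ∈ Set.Icc (0 : ℝ) 1 ∧ bkl q p ≤ ε}


/-- Maurer's constant `∑ₖ C(N,k) (k/N)ᵏ (1-k/N)ᴺ⁻ᵏ`. -/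
noncomputable def maurerSum (N : ℕ) : ℝ :=
  ∑ k ∈ Finset.range (N + 1), (N.choose k : ℝ) * ((k / N : ℝ) ^ k * (1 - k / N : ℝ) ^ (N - k))

lemma sum_inv_sqrt_le (n : ℕ) (hn : 0 < n) :
    ∑ k ∈ Finset.Ico 1 (n + 1), 1 / √(k : ℝ) ≤ 2 * √n - 1 := by
  induction n, hn using Nat.le_induction with
  | base => norm_num
  | succ n hn ih =>
    rw [Finset.sum_Ico_succ_top (by omega)]
    have hs : 0 < √((n : ℝ) + 1) := Real.sqrt_pos.2 (by positivity)
    have h1 : √((n : ℝ) + 1) ^ 2 = n + 1 := Real.sq_sqrt (by positivity)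
    have h2 : √(n : ℝ) ^ 2 = n := Real.sq_sqrt (by positivity)
    have h3 : 1 / √((n : ℝ) + 1) ≤ 2 * √((n : ℝ) + 1) - 2 * √n := by
      rw [div_le_iff₀ hs]
      nlinarith [sq_nonneg (√((n : ℝ) + 1) - √n)]
    push_cast
    linarith

lemma one_div_sqrt_mul_sqrt_le {a b : ℝ} (ha : 0 < a) (hb : 0 < b) :
    1 / (√a * √b) ≤ 1 / √(a + b) * (1 / √a + 1 / √b) := by
  have h1 := Real.sqrt_pos.2 ha
  have h2 := Real.sqrt_pos.2 hb
  have h3 := Real.sqrt_pos.2 (add_pos ha hb)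
  have h4 : √(a + b) ≤ √a + √b := by
    refine Real.sqrt_le_iff.2 ⟨by positivity, ?_⟩
    nlinarith [Real.sq_sqrt ha.le, Real.sq_sqrt hb.le]
  have e : 1 / √(a + b) * (1 / √a + 1 / √b) = (1 / (√a * √b)) * ((√a + √b) / √(a + b)) := by
    field_simp
    ring
  rw [e]
  exact le_mul_of_one_le_right (by positivity) ((one_le_div h3).2 h4)

lemma sum_one_div_sqrt_mul_sqrt_le (N : ℕ) (hN : 1 < N) :
    ∑ k ∈ Finset.Ico 1 N, 1 / (√(k : ℝ) * √((N - k : ℕ) : ℝ)) ≤ 4 - 2 / √(N : ℝ) := by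
  have hs : 0 < √(N : ℝ) := Real.sqrt_pos.2 (by positivity)
  have hsum : ∑ k ∈ Finset.Ico 1 N, 1 / √(k : ℝ) ≤ 2 * √N - 1 := by
    have h := sum_inv_sqrt_le (N - 1) (by omega)
    rw [Nat.sub_add_cancel hN.le] at h
    have h' : √((N - 1 : ℕ) : ℝ) ≤ √(N : ℝ) := by
      gcongr
      omega
    linarith
  have hrefl : ∑ k ∈ Finset.Ico 1 N, 1 / √((N - k : ℕ) : ℝ) = ∑ k ∈ Finset.Ico 1 N, 1 / √(k : ℝ) := by
    have h := Finset.sum_Ico_reflect (fun k : ℕ => 1 / √(k : ℝ)) 1 (m := N) (n := N) (by omega)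
    simpa [Nat.add_sub_cancel_left] using h
  calc
    _ ≤ ∑ k ∈ Finset.Ico 1 N, 1 / √(N : ℝ) * (1 / √(k : ℝ) + 1 / √((N - k : ℕ) : ℝ)) := by
      refine Finset.sum_le_sum fun k hk => ?_
      rw [Finset.mem_Ico] at hk
      have h := one_div_sqrt_mul_sqrt_le (a := k) (b := (N - k : ℕ)) (by exact_mod_cast hk.1)
        (by exact_mod_cast (by omega : 0 < N - k))
      rwa [← Nat.cast_add, Nat.add_sub_cancel' hk.2.le] at h
    _ = 1 / √(N : ℝ) * (2 * ∑ k ∈ Finset.Ico 1 N, 1 / √(k : ℝ)) := by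
      rw [← Finset.mul_sum, Finset.sum_add_distrib, hrefl, two_mul]
    _ ≤ 1 / √(N : ℝ) * (2 * (2 * √N - 1)) := by gcongr
    _ = 4 - 2 / √(N : ℝ) := by
      field_simp
      ring

lemma factorial_le_stirling (n : ℕ) (hn : 0 < n) :
    (n.factorial : ℝ) ≤ Real.exp 1 * √n * (n / Real.exp 1) ^ n := by
  have h := Stirling.stirlingSeq'_antitone (Nat.zero_le (n - 1))
  simp only [Function.comp, Nat.succ_eq_add_one, zero_add, Nat.sub_add_cancel hn,
    Stirling.stirlingSeq_one] at h
  rw [Stirling.stirlingSeq, div_le_iff₀ (by positivity)] at h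
  refine h.trans (le_of_eq ?_)
  rw [Real.sqrt_mul (by norm_num)]
  field_simp

lemma pow_self_le_factorial (k : ℕ) (hk : 0 < k) :
    (k : ℝ) ^ k ≤ k.factorial * Real.exp 1 ^ k / (√(2 * Real.pi) * √k) := by
  have h := Stirling.le_factorial_stirling k
  rw [Real.sqrt_mul (by positivity), div_pow] at h
  rw [le_div_iff₀ (by positivity)]
  calc _ = √(2 * Real.pi) * √k * (k ^ k / Real.exp 1 ^ k) * Real.exp 1 ^ k := by field_simp
    _ ≤ _ := by gcongr

lemma maurerSum_term_le (N k : ℕ) (hk : 0 < k) (hkN : k < N) :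
    (N.choose k : ℝ) * ((k / N : ℝ) ^ k * (1 - k / N : ℝ) ^ (N - k)) ≤
      Real.exp 1 * √N / (2 * Real.pi) * (1 / (√(k : ℝ) * √((N - k : ℕ) : ℝ))) := by
  have hN : 0 < N := hk.trans hkN
  have hm : 0 < N - k := by omega
  have e1 : (1 - k / N : ℝ) = ((N - k : ℕ) : ℝ) / N := by
    rw [Nat.cast_sub hkN.le]
    field_simp
  have e2 : (N.choose k : ℝ) = N.factorial / (k.factorial * (N - k).factorial) :=
    Nat.cast_choose ℝ hkN.le
  have e3 : (N : ℝ) ^ N = N ^ k * N ^ (N - k) := by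
    rw [← pow_add, Nat.add_sub_cancel' hkN.le]
  have e4 : Real.exp 1 ^ N = Real.exp 1 ^ k * Real.exp 1 ^ (N - k) := by
    rw [← pow_add, Nat.add_sub_cancel' hkN.le]
  have e5 : √(2 * Real.pi) * √(2 * Real.pi) = 2 * Real.pi := Real.mul_self_sqrt (by positivity)
  have hN1 := factorial_le_stirling N hN
  have hk1 := pow_self_le_factorial k hk
  have hm1 := pow_self_le_factorial (N - k) hm
  generalize N - k = m at *
  have hk0 : (0 : ℝ) < k := by exact_mod_cast hk
  have hm0 : (0 : ℝ) < m := by exact_mod_cast hm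
  have hN0 : (0 : ℝ) < N := by exact_mod_cast hN
  rw [e1, e2, div_pow, div_pow]
  calc _ = N.factorial / (k.factorial * m.factorial * N ^ N) * ((k : ℝ) ^ k * (m : ℝ) ^ m) := by
        rw [e3]
        field_simp
    _ ≤ (Real.exp 1 * √N * (N / Real.exp 1) ^ N) / (k.factorial * m.factorial * N ^ N) *
        ((k.factorial * Real.exp 1 ^ k / (√(2 * Real.pi) * √k)) *
          (m.factorial * Real.exp 1 ^ m / (√(2 * Real.pi) * √m))) := by gcongr
    _ = Real.exp 1 * √N / (√(2 * Real.pi) * √(2 * Real.pi)) * (1 / (√(k : ℝ) * √(m : ℝ))) := by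
        rw [div_pow, e4]
        field_simp
    _ = _ := by rw [e5]

lemma maurerSum_le_of_lt (N : ℕ) (hN : 0 < N) (hN' : N < 18) : maurerSum N ≤ 2 * √N := by
  have hnat : (∑ k ∈ Finset.range (N + 1), N.choose k * (k ^ k * (N - k) ^ (N - k))) ^ 2 ≤
      4 * N * (N ^ N) ^ 2 := by
    interval_cases N <;> decide +kernel
  have e : maurerSum N * N ^ N =
      ((∑ k ∈ Finset.range (N + 1), N.choose k * (k ^ k * (N - k) ^ (N - k)) : ℕ) : ℝ) := by
    rw [maurerSum, Finset.sum_mul]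
    push_cast
    refine Finset.sum_congr rfl fun k hk => ?_
    have hkN : k ≤ N := by
      rw [Finset.mem_range] at hk
      omega
    have e3 : (N : ℝ) ^ N = N ^ k * N ^ (N - k) := by
      rw [← pow_add, Nat.add_sub_cancel' hkN]
    have e1 : (1 - k / N : ℝ) = ((N - k : ℕ) : ℝ) / N := by
      rw [Nat.cast_sub hkN]
      field_simp
    rw [e1, e3, div_pow, div_pow]
    field_simp
  have hpow : (0 : ℝ) < (N : ℝ) ^ N := by positivity
  refine le_of_mul_le_mul_right ?_ hpow
  rw [e]
  refine abs_le_of_sq_le_sq' ?_ (by positivity) |>.2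
  rw [mul_pow, mul_pow, Real.sq_sqrt (by positivity)]
  norm_num only
  exact_mod_cast hnat

lemma maurerSum_le (N : ℕ) (hN : 0 < N) : maurerSum N ≤ 2 * √N := by
  rcases lt_or_ge N 18 with h | h
  · exact maurerSum_le_of_lt N hN h
  have hN0 : (0 : ℝ) < N := by exact_mod_cast hN
  have hs : 0 < √(N : ℝ) := Real.sqrt_pos.2 hN0
  have hmain : maurerSum N ≤ 2 + Real.exp 1 * √N / (2 * Real.pi) * (4 - 2 / √(N : ℝ)) := by
    rw [maurerSum, Finset.sum_range_succ, Finset.range_eq_Ico, Finset.sum_eq_sum_Ico_succ_bot hN]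
    have h1 : ∑ k ∈ Finset.Ico (0 + 1) N,
        (N.choose k : ℝ) * ((k / N : ℝ) ^ k * (1 - k / N : ℝ) ^ (N - k)) ≤
        Real.exp 1 * √N / (2 * Real.pi) * (4 - 2 / √(N : ℝ)) := by
      calc _ ≤ ∑ k ∈ Finset.Ico 1 N, Real.exp 1 * √N / (2 * Real.pi) *
            (1 / (√(k : ℝ) * √((N - k : ℕ) : ℝ))) := by
            refine Finset.sum_le_sum fun k hk => ?_
            rw [Finset.mem_Ico] at hk
            exact maurerSum_term_le N k hk.1 hk.2
        _ ≤ _ := by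
            rw [← Finset.mul_sum]
            gcongr
            exact sum_one_div_sqrt_mul_sqrt_le N (by omega)
    have h2 : (N / N : ℝ) = 1 := div_self hN0.ne'
    simp only [Nat.choose_self, h2, Nat.choose_zero_right, Nat.sub_self]
    norm_num at h1 ⊢
    linarith
  refine hmain.trans ?_
  have e : Real.exp 1 * √N / (2 * Real.pi) * (4 - 2 / √(N : ℝ)) =
      (Real.exp 1 / Real.pi) * (2 * √N - 1) := by
    field_simp
    ring
  have hr : Real.exp 1 / Real.pi ≤ 0.8654 := by
    rw [div_le_iff₀ Real.pi_pos]
    linarith [Real.exp_one_lt_d9, Real.pi_gt_d4]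
  have hs4 : 4.24 ≤ √(N : ℝ) := by
    refine Real.le_sqrt_of_sq_le ?_
    have : (18 : ℝ) ≤ N := by exact_mod_cast h
    norm_num
    linarith
  rw [e]
  nlinarith

/-- Binary relative entropy as a real number, written so that it is convex in `q` for every `p`. -/
noncomputable def realBkl (q p : ℝ) : ℝ :=
  q * Real.log q - q * Real.log p +
    ((1 - q) * Real.log (1 - q) - (1 - q) * Real.log (1 - p))

lemma convexOn_realBkl (p : ℝ) : ConvexOn ℝ (Set.Icc 0 1) fun q => realBkl q p := by
  have h1 : ConvexOn ℝ (Set.Icc (0 : ℝ) 1) fun q => q * Real.log q :=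
    Real.convexOn_mul_log.subset Set.Icc_subset_Ici_self (convex_Icc 0 1)
  have h2 : ConvexOn ℝ (Set.Icc (0 : ℝ) 1) fun q => (1 - q) * Real.log (1 - q) := by
    refine ⟨convex_Icc 0 1, fun x hx y hy a b ha hb hab => ?_⟩
    have h := h1.2 (x := 1 - x) ⟨by linarith [hx.2], by linarith [hx.1]⟩
      (y := 1 - y) ⟨by linarith [hy.2], by linarith [hy.1]⟩ ha hb hab
    simp only [smul_eq_mul] at h ⊢
    have e : 1 - (a * x + b * y) = a * (1 - x) + b * (1 - y) := by linear_combination -hab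
    rwa [e]
  refine ⟨convex_Icc 0 1, fun x hx y hy a b ha hb hab => ?_⟩
  have g1 := h1.2 hx hy ha hb hab
  have g2 := h2.2 hx hy ha hb hab
  simp only [smul_eq_mul, realBkl] at g1 g2 ⊢
  obtain rfl : b = 1 - a := by linarith
  nlinarith

lemma convexOn_exp_realBkl (N : ℕ) (p : ℝ) :
    ConvexOn ℝ (Set.Icc 0 1) fun q => Real.exp (N * realBkl q p) := by
  refine ⟨convex_Icc 0 1, fun x hx y hy a b ha hb hab => ?_⟩
  have h := (convexOn_realBkl p).2 hx hy ha hb hab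
  refine le_trans ?_ (convexOn_exp.2 (Set.mem_univ _) (Set.mem_univ _) ha hb hab)
  simp only [smul_eq_mul] at h ⊢
  refine Real.exp_le_exp.2 ?_
  calc _ ≤ N * (a * realBkl x p + b * realBkl y p) := by gcongr
    _ = _ := by ring

lemma measurable_realBkl : Measurable fun x : ℝ × ℝ => realBkl x.1 x.2 := by
  unfold realBkl
  fun_prop

/-- The probability of `t` under the product of Bernoulli distributions with parameters `x i`. -/
noncomputable def bernoulliWeight {ι : Type*} [Fintype ι] (x : ι → ℝ) (t : Finset ι) : ℝ :=
  ∏ i, if i ∈ t then x i else 1 - x i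

section bernoulliWeight

variable {ι : Type*} [Fintype ι]

lemma sum_prod_ite_mem (a b : ι → ℝ) :
    ∑ t : Finset ι, ∏ i, (if i ∈ t then a i else b i) = ∏ i, (a i + b i) := by
  rw [Fintype.prod_add]
  refine Finset.sum_congr rfl fun t _ => ?_
  rw [Finset.prod_ite]
  congr 2 <;> ext i <;> simp

lemma sum_bernoulliWeight (x : ι → ℝ) : ∑ t, bernoulliWeight x t = 1 := by
  simp [bernoulliWeight, sum_prod_ite_mem]

lemma bernoulliWeight_nonneg {x : ι → ℝ} (hx : ∀ i, x i ∈ Set.Icc (0 : ℝ) 1) (t : Finset ι) :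
    0 ≤ bernoulliWeight x t := by
  refine Finset.prod_nonneg fun i _ => ?_
  split_ifs
  · exact (hx i).1
  · exact sub_nonneg.2 (hx i).2

lemma sum_bernoulliWeight_mul_indicator (x : ι → ℝ) (j : ι) :
    ∑ t, bernoulliWeight x t * (if j ∈ t then 1 else 0) = x j := by
  have h : ∀ t : Finset ι, bernoulliWeight x t * (if j ∈ t then 1 else 0) =
      ∏ i, (if i ∈ t then x i else if i = j then 0 else 1 - x i) := by
    intro t
    by_cases hj : j ∈ t
    · rw [if_pos hj, mul_one]
      refine Finset.prod_congr rfl fun i _ => ?_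
      by_cases hi : i ∈ t
      · simp [hi]
      · rw [if_neg hi, if_neg hi, if_neg (fun h : i = j => hi (h ▸ hj))]
    · rw [if_neg hj, mul_zero, Finset.prod_eq_zero (Finset.mem_univ j)]
      simp [hj]
  simp_rw [h]
  rw [sum_prod_ite_mem, Finset.prod_eq_single j]
  · simp
  · intro i _ hi
    simp [hi]
  · simp

lemma sum_bernoulliWeight_mul_card (x : ι → ℝ) :
    ∑ t, bernoulliWeight x t * (t.card : ℝ) = ∑ i, x i := by
  have h : ∀ t : Finset ι, (t.card : ℝ) = ∑ j, if j ∈ t then (1 : ℝ) else 0 := by simp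
  simp_rw [h, Finset.mul_sum]
  rw [Finset.sum_comm]
  exact Finset.sum_congr rfl fun j _ => sum_bernoulliWeight_mul_indicator x j

lemma ConvexOn.map_mean_le_sum_bernoulliWeight {φ : ℝ → ℝ}
    (hφ : ConvexOn ℝ (Set.Icc 0 1) φ) {x : ι → ℝ} (hx : ∀ i, x i ∈ Set.Icc (0 : ℝ) 1) :
    φ ((Fintype.card ι : ℝ)⁻¹ * ∑ i, x i) ≤
      ∑ t, bernoulliWeight x t * φ ((Fintype.card ι : ℝ)⁻¹ * (t.card : ℝ)) := by
  have h := hφ.map_sum_le (t := Finset.univ) (w := bernoulliWeight x)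
    (p := fun t : Finset ι => (Fintype.card ι : ℝ)⁻¹ * (t.card : ℝ))
    (fun t _ => bernoulliWeight_nonneg hx t) (sum_bernoulliWeight x) (fun t _ => ?_)
  · have e : (Fintype.card ι : ℝ)⁻¹ * ∑ i, x i =
        ∑ t, bernoulliWeight x t • ((Fintype.card ι : ℝ)⁻¹ * (t.card : ℝ)) := by
      rw [← sum_bernoulliWeight_mul_card, Finset.mul_sum]
      exact Finset.sum_congr rfl fun t _ => mul_left_comm _ _ _
    rwa [e]
  · refine ⟨by positivity, ?_⟩
    rw [← div_eq_inv_mul]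
    exact div_le_one_of_le₀ (by exact_mod_cast Finset.card_le_univ t) (by positivity)

lemma bernoulliWeight_const (p : ℝ) (t : Finset ι) :
    bernoulliWeight (fun _ => p) t = p ^ t.card * (1 - p) ^ (Fintype.card ι - t.card) := by
  rw [bernoulliWeight, Finset.prod_ite, Finset.prod_const, Finset.prod_const]
  congr 2
  · simp
  · rw [← Finset.card_compl]
    congr 1
    ext i
    simp

lemma integrable_bernoulliWeight {Z : Type*} [MeasurableSpace Z] (ν : Measure Z)
    [IsProbabilityMeasure ν] {f : Z → ℝ} (hf : Integrable f ν) (t : Finset ι) :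
    Integrable (fun S : ι → Z => bernoulliWeight (fun i => f (S i)) t) (Measure.pi fun _ => ν) := by
  refine Integrable.fintype_prod (f := fun i z => if i ∈ t then f z else 1 - f z) fun i => ?_
  split_ifs
  · exact hf
  · exact (integrable_const 1).sub hf

lemma integral_bernoulliWeight {Z : Type*} [MeasurableSpace Z] (ν : Measure Z)
    [IsProbabilityMeasure ν] {f : Z → ℝ} (hf : Integrable f ν) (t : Finset ι) :
    ∫ S : ι → Z, bernoulliWeight (fun i => f (S i)) t ∂(Measure.pi fun _ => ν) =
      bernoulliWeight (fun _ => ∫ z, f z ∂ν) t := by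
  unfold bernoulliWeight
  rw [integral_fintype_prod_eq_prod (fun i z => if i ∈ t then f z else 1 - f z)]
  refine Finset.prod_congr rfl fun i _ => ?_
  split_ifs
  · rfl
  · rw [integral_sub (integrable_const 1) hf]
    simp

end bernoulliWeight

lemma pow_mul_exp_le {a p : ℝ} (hp : 0 ≤ p) (ha : 0 ≤ a) (N k : ℕ) (hk : (k : ℝ) = N * a) :
    p ^ k * Real.exp (N * (a * Real.log a - a * Real.log p)) ≤ a ^ k := by
  have e : (N * (a * Real.log a - a * Real.log p) : ℝ) = k * Real.log a - k * Real.log p := by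
    rw [hk]
    ring
  rw [e, Real.exp_sub, Real.exp_nat_mul, Real.exp_nat_mul]
  rcases Nat.eq_zero_or_pos k with rfl | hk0
  · simp
  have ha0 : 0 < a := by
    refine lt_of_le_of_ne ha fun h => ?_
    rw [← h, mul_zero] at hk
    exact hk0.ne' (by exact_mod_cast hk)
  rcases hp.eq_or_lt with rfl | hp0
  · rw [zero_pow hk0.ne', zero_mul]
    positivity
  · rw [Real.exp_log ha0, Real.exp_log hp0]
    field_simp
    exact le_rfl

lemma sum_bernoulliWeight_const_mul_exp_le (N : ℕ) (hN : 0 < N) {p : ℝ}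
    (hp : p ∈ Set.Icc (0 : ℝ) 1) :
    ∑ t : Finset (Fin N), bernoulliWeight (fun _ => p) t *
      Real.exp (N * realBkl ((N : ℝ)⁻¹ * (t.card : ℝ)) p) ≤ maurerSum N := by
  have hN0 : (0 : ℝ) < N := by exact_mod_cast hN
  simp_rw [bernoulliWeight_const, Fintype.card_fin]
  have h := Finset.sum_powerset_apply_card (fun k => p ^ k * (1 - p) ^ (N - k) *
    Real.exp (N * realBkl ((N : ℝ)⁻¹ * (k : ℝ)) p)) (x := (Finset.univ : Finset (Fin N)))
  rw [Finset.powerset_univ, Finset.card_univ, Fintype.card_fin] at h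
  rw [h, maurerSum]
  refine Finset.sum_le_sum fun k hk => ?_
  have hkN : k ≤ N := by
    rw [Finset.mem_range] at hk
    omega
  have hkN' : (k : ℝ) ≤ N := by exact_mod_cast hkN
  have hle : (k / N : ℝ) ≤ 1 := div_le_one_of_le₀ hkN' hN0.le
  rw [nsmul_eq_mul, ← div_eq_inv_mul, realBkl, mul_add, Real.exp_add]
  refine mul_le_mul_of_nonneg_left ?_ (Nat.cast_nonneg _)
  calc _ = (p ^ k * Real.exp (N * (k / N * Real.log (k / N) - k / N * Real.log p))) *
        ((1 - p) ^ (N - k) * Real.exp (N * ((1 - k / N) * Real.log (1 - k / N) -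
          (1 - k / N) * Real.log (1 - p)))) := by ring
    _ ≤ _ := by
      refine mul_le_mul (pow_mul_exp_le hp.1 (by positivity) N k (by field_simp))
        (pow_mul_exp_le (sub_nonneg.2 hp.2) (sub_nonneg.2 hle) N (N - k) ?_) ?_ (by positivity)
      · rw [Nat.cast_sub hkN]
        field_simp
      · have := sub_nonneg.2 hp.2
        positivity

/-- **Maurer's inequality.** The exponential moment of `N · kl` between the empirical mean and the
mean of `[0,1]`-valued i.i.d. variables is at most `2√N`. -/
lemma lintegral_exp_realBkl_mean_le {Z : Type*} [MeasurableSpace Z] (ν : Measure Z)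
    [IsProbabilityMeasure ν] (N : ℕ) (hN : 0 < N) {f : Z → ℝ} (hf : Measurable f)
    (hf01 : ∀ z, f z ∈ Set.Icc (0 : ℝ) 1) :
    ∫⁻ S : Fin N → Z, ENNReal.ofReal (Real.exp (N * realBkl ((N : ℝ)⁻¹ * ∑ i, f (S i))
      (∫ z, f z ∂ν))) ∂(Measure.pi fun _ => ν) ≤ ENNReal.ofReal (2 * √N) := by
  have hfi : Integrable f ν := by
    refine Integrable.of_bound hf.aestronglyMeasurable 1 (Filter.Eventually.of_forall fun z => ?_)
    rw [Real.norm_eq_abs, abs_of_nonneg (hf01 z).1]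
    exact (hf01 z).2
  set p := ∫ z, f z ∂ν with hpdef
  have hp : p ∈ Set.Icc (0 : ℝ) 1 := by
    refine ⟨integral_nonneg fun z => (hf01 z).1, ?_⟩
    have h := integral_mono hfi (integrable_const (1 : ℝ)) fun z => (hf01 z).2
    simpa using h
  let F : (Fin N → Z) → ℝ := fun S => ∑ t : Finset (Fin N),
    bernoulliWeight (fun i => f (S i)) t *
      Real.exp (N * realBkl ((N : ℝ)⁻¹ * (t.card : ℝ)) p)
  have hFi : Integrable F (Measure.pi fun _ => ν) :=
    integrable_finsetSum _ fun t _ => (integrable_bernoulliWeight ν hfi t).mul_const _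
  have hF0 : ∀ S, 0 ≤ F S := fun S => Finset.sum_nonneg fun t _ =>
    mul_nonneg (bernoulliWeight_nonneg (fun i => hf01 _) t) (Real.exp_pos _).le
  calc _ ≤ ∫⁻ S : Fin N → Z, ENNReal.ofReal (F S) ∂(Measure.pi fun _ => ν) := by
        refine lintegral_mono fun S => ENNReal.ofReal_le_ofReal ?_
        have h := (convexOn_exp_realBkl N p).map_mean_le_sum_bernoulliWeight
          (x := fun i => f (S i)) fun i => hf01 _
        simpa only [Fintype.card_fin] using h
    _ = ENNReal.ofReal (∫ S : Fin N → Z, F S ∂(Measure.pi fun _ => ν)) :=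
        (ofReal_integral_eq_lintegral_ofReal hFi (Filter.Eventually.of_forall hF0)).symm
    _ ≤ _ := by
        refine ENNReal.ofReal_le_ofReal ?_
        rw [integral_finsetSum _ fun t _ => (integrable_bernoulliWeight ν hfi t).mul_const _]
        simp_rw [integral_mul_const, integral_bernoulliWeight ν hfi]
        exact (sum_bernoulliWeight_const_mul_exp_le N hN hp).trans (maurerSum_le N hN)

lemma mul_log_tangent_le {a b u : ℝ} (ha : 0 ≤ a) (hb : 0 ≤ b) (hu : 0 ≤ u) (hba : b = 0 → a = 0)
    (hua : u = 0 → a = 0) :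
    a * Real.log u - b * u + a ≤ a * Real.log a - a * Real.log b := by
  rcases ha.eq_or_lt with rfl | ha0
  · simpa using mul_nonneg hb hu
  have hb0 : 0 < b := lt_of_le_of_ne hb fun h => ha0.ne' (hba h.symm)
  have hu0 : 0 < u := lt_of_le_of_ne hu fun h => ha0.ne' (hua h.symm)
  have h := Real.log_le_sub_one_of_pos (show 0 < b * u / a by positivity)
  rw [Real.log_div (by positivity) ha0.ne', Real.log_mul hb0.ne' hu0.ne'] at h
  have h' := mul_le_mul_of_nonneg_left h ha0.le
  have e : a * (b * u / a - 1) = b * u - a := by field_simp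
  linarith

section changeOfMeasure

variable {H : Type*} [MeasurableSpace H] {P Q : Measure H} [IsProbabilityMeasure P]
  [IsProbabilityMeasure Q]

/-- Change of measure (one half of the Donsker–Varadhan formula). -/
lemma integral_le_integral_llr_add_log (hQP : Q ≪ P) (hllr : Integrable (llr Q P) Q)
    {L g : H → ℝ} (hL : Integrable L Q) (hg : Measurable g) (hLg : ∀ᵐ h ∂Q, L h ≤ g h)
    {c : ℝ} (hc : 0 < c) (hgc : ∫⁻ h, ENNReal.ofReal (Real.exp (g h)) ∂P ≤ ENNReal.ofReal c) :
    ∫ h, L h ∂Q ≤ ∫ h, llr Q P h ∂Q + Real.log c := by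
  have hD : Integrable (fun h => L h - llr Q P h) Q := hL.sub hllr
  have hlin : ∫⁻ h, ENNReal.ofReal (Real.exp (L h - llr Q P h)) ∂Q ≤ ENNReal.ofReal c := by
    have hmeas : Measurable fun h => ENNReal.ofReal (Real.exp (g h)) := by fun_prop
    calc _ ≤ ∫⁻ h, (P.rnDeriv Q * fun h => ENNReal.ofReal (Real.exp (g h))) h ∂Q := by
          refine lintegral_mono_ae ?_
          filter_upwards [hLg, exp_neg_llr hQP] with h h1 h2
          rw [sub_eq_add_neg, Real.exp_add, h2, ENNReal.ofReal_mul (Real.exp_pos _).le,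
            Pi.mul_apply, mul_comm]
          gcongr
          exact ENNReal.ofReal_toReal_le
      _ = ∫⁻ h, ENNReal.ofReal (Real.exp (g h)) ∂(Q.withDensity (P.rnDeriv Q)) :=
          (lintegral_withDensity_eq_lintegral_mul Q (Measure.measurable_rnDeriv P Q) hmeas).symm
      _ ≤ ∫⁻ h, ENNReal.ofReal (Real.exp (g h)) ∂P :=
          lintegral_mono' (Measure.withDensity_rnDeriv_le P Q) le_rfl
      _ ≤ _ := hgc
  have hexp_meas : AEStronglyMeasurable (fun h => Real.exp (L h - llr Q P h)) Q :=
    Real.continuous_exp.comp_aestronglyMeasurable hD.aestronglyMeasurable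
  have hexp0 : 0 ≤ᵐ[Q] fun h => Real.exp (L h - llr Q P h) :=
    Filter.Eventually.of_forall fun h => (Real.exp_pos _).le
  have hexp : Integrable (fun h => Real.exp (L h - llr Q P h)) Q :=
    ⟨hexp_meas, (hasFiniteIntegral_iff_ofReal hexp0).2 (hlin.trans_lt ENNReal.ofReal_lt_top)⟩
  have hexp_le : ∫ h, Real.exp (L h - llr Q P h) ∂Q ≤ c := by
    rw [integral_eq_lintegral_of_nonneg_ae hexp0 hexp_meas]
    exact ENNReal.toReal_le_of_le_ofReal hc.le hlin
  have hmono : ∫ h, (L h - llr Q P h) ∂Q ≤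
      ∫ h, (c⁻¹ * Real.exp (L h - llr Q P h) + (Real.log c - 1)) ∂Q := by
    refine integral_mono hD ((hexp.const_mul _).add (integrable_const _)) fun h => ?_
    have h1 := Real.add_one_le_exp (L h - llr Q P h - Real.log c)
    rw [Real.exp_sub _ (Real.log c), Real.exp_log hc, div_eq_inv_mul] at h1
    simp only
    linarith
  rw [integral_sub hL hllr, integral_add (hexp.const_mul _) (integrable_const _),
    integral_const_mul, integral_const, probReal_univ, one_smul] at hmono
  have : c⁻¹ * ∫ h, Real.exp (L h - llr Q P h) ∂Q ≤ 1 := by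
    rw [inv_mul_le_iff₀ hc, mul_one]
    exact hexp_le
  linarith

lemma integrable_of_mem_Icc {r : H → ℝ} (hr : Measurable r)
    (hr01 : ∀ h, r h ∈ Set.Icc (0 : ℝ) 1) : Integrable r Q := by
  refine Integrable.of_bound hr.aestronglyMeasurable 1 (Filter.Eventually.of_forall fun h => ?_)
  rw [Real.norm_eq_abs, abs_of_nonneg (hr01 h).1]
  exact (hr01 h).2

lemma integral_mem_Icc {r : H → ℝ} (hr : Measurable r)
    (hr01 : ∀ h, r h ∈ Set.Icc (0 : ℝ) 1) : ∫ h, r h ∂Q ∈ Set.Icc (0 : ℝ) 1 := by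
  refine ⟨integral_nonneg fun h => (hr01 h).1, ?_⟩
  simpa using integral_mono (integrable_of_mem_Icc (Q := Q) hr hr01) (integrable_const (1 : ℝ))
    fun h => (hr01 h).2

lemma ae_eq_zero_of_integral_eq_zero {r : H → ℝ} (hr : Measurable r)
    (hr01 : ∀ h, r h ∈ Set.Icc (0 : ℝ) 1) (h0 : ∫ h, r h ∂Q = 0) : ∀ᵐ h ∂Q, r h = 0 :=
  (integral_eq_zero_iff_of_nonneg (fun h => (hr01 h).1) (integrable_of_mem_Icc hr hr01)).1 h0

lemma ae_eq_one_of_integral_eq_one {r : H → ℝ} (hr : Measurable r)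
    (hr01 : ∀ h, r h ∈ Set.Icc (0 : ℝ) 1) (h1 : ∫ h, r h ∂Q = 1) : ∀ᵐ h ∂Q, r h = 1 := by
  have h := ae_eq_zero_of_integral_eq_zero (Q := Q) (r := fun h => 1 - r h) (by fun_prop)
    (fun h => ⟨by linarith [(hr01 h).2], by linarith [(hr01 h).1]⟩) (by
      rw [integral_sub (integrable_const _) (integrable_of_mem_Icc hr hr01), h1]
      simp)
  filter_upwards [h] with x hx
  linarith

lemma le_klInv {q p : ℝ} {ε : ℝ≥0∞} (hp : p ∈ Set.Icc (0 : ℝ) 1) (h : bkl q p ≤ ε) :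
    p ≤ klInv q ε :=
  le_csSup ⟨1, fun _ hx => hx.1.2⟩ ⟨hp, h⟩

lemma klInv_nonneg (q : ℝ) (ε : ℝ≥0∞) : 0 ≤ klInv q ε :=
  Real.sSup_nonneg fun _ hx => hx.1.1

/-- The deterministic part of the PAC-Bayesian bound: an exponential moment bound under `P`
controls the averages of the risks `s` (empirical) and `r` (true) under every `Q`. -/
lemma integral_le_klInv (hQP : Q ≪ P) (hllr : Integrable (llr Q P) Q) {s r : H → ℝ}
    (hs : Measurable s) (hr : Measurable r) (hs01 : ∀ h, s h ∈ Set.Icc (0 : ℝ) 1)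
    (hr01 : ∀ h, r h ∈ Set.Icc (0 : ℝ) 1) (h0 : ∀ᵐ h ∂P, r h = 0 → s h = 0)
    (h1 : ∀ᵐ h ∂P, r h = 1 → s h = 1) {n c : ℝ} (hn : 0 < n) (hc : 0 < c)
    (hM : ∫⁻ h, ENNReal.ofReal (Real.exp (n * realBkl (s h) (r h))) ∂P ≤ ENNReal.ofReal c) :
    ∫ h, r h ∂Q ≤ klInv (∫ h, s h ∂Q)
      (ENNReal.ofReal ((∫ h, llr Q P h ∂Q + Real.log c) / n)) := by
  have hq := integral_mem_Icc (Q := Q) hs hs01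
  have hp := integral_mem_Icc (Q := Q) hr hr01
  have hsi := integrable_of_mem_Icc (Q := Q) hs hs01
  have hri := integrable_of_mem_Icc (Q := Q) hr hr01
  have hs0 := ae_eq_zero_of_integral_eq_zero (Q := Q) hs hs01
  have hs1 := ae_eq_one_of_integral_eq_one (Q := Q) hs hs01
  have hr1 := ae_eq_one_of_integral_eq_one (Q := Q) hr hr01
  set q := ∫ h, s h ∂Q with hqdef
  set p := ∫ h, r h ∂Q with hpdef
  rcases hp.1.eq_or_lt with hp0 | hp0
  · rw [← hp0]
    exact klInv_nonneg _ _
  refine le_klInv hp ?_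
  unfold bkl
  split_ifs with hqp hp01
  · exact zero_le
  · rcases hp01 with hp0' | hp1
    · exact absurd hp0' hp0.ne'
    · refine absurd ?_ hqp
      have hae : s =ᵐ[Q] fun _ => 1 := by
        filter_upwards [hr1 hp1, hQP.ae_le h1] with h ha hb using hb ha
      rw [hp1, hqdef, integral_congr_ae hae]
      simp
  have hp1 : 0 < 1 - p := sub_pos.2 (lt_of_le_of_ne hp.2 fun h => hp01 (Or.inr h))
  refine ENNReal.ofReal_le_ofReal ?_
  rw [le_div_iff₀ hn, mul_comm]
  have hq1 : 0 ≤ 1 - q := sub_nonneg.2 hq.2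
  let L : H → ℝ := fun h => n * ((s h * Real.log (q / p) - r h * (q / p) + s h) +
    ((1 - s h) * Real.log ((1 - q) / (1 - p)) - (1 - r h) * ((1 - q) / (1 - p)) + (1 - s h)))
  have hi1 : Integrable (fun h => 1 - s h) Q := (integrable_const 1).sub hsi
  have hi2 : Integrable (fun h => 1 - r h) Q := (integrable_const 1).sub hri
  have hia : Integrable (fun h => s h * Real.log (q / p) - r h * (q / p)) Q :=
    (hsi.mul_const _).sub (hri.mul_const _)
  have hib : Integrable (fun h => (1 - s h) * Real.log ((1 - q) / (1 - p)) -
    (1 - r h) * ((1 - q) / (1 - p))) Q := (hi1.mul_const _).sub (hi2.mul_const _)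
  have hia' : Integrable (fun h => s h * Real.log (q / p) - r h * (q / p) + s h) Q := hia.add hsi
  have hib' : Integrable (fun h => (1 - s h) * Real.log ((1 - q) / (1 - p)) -
    (1 - r h) * ((1 - q) / (1 - p)) + (1 - s h)) Q := hib.add hi1
  have hLi : Integrable L Q := (hia'.add hib').const_mul n
  have hLint : ∫ h, L h ∂Q =
      n * (q * Real.log (q / p) + (1 - q) * Real.log ((1 - q) / (1 - p))) := by
    have e1 : ∫ h, (1 - s h) ∂Q = 1 - q := by
      rw [integral_sub (integrable_const _) hsi]
      simp [hqdef]
    have e2 : ∫ h, (1 - r h) ∂Q = 1 - p := by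
      rw [integral_sub (integrable_const _) hri]
      simp [hpdef]
    rw [integral_const_mul, integral_add hia' hib', integral_add hia hsi,
      integral_add hib hi1, integral_sub (hsi.mul_const _) (hri.mul_const _),
      integral_sub (hi1.mul_const _) (hi2.mul_const _)]
    simp only [integral_mul_const, e1, e2, ← hqdef, ← hpdef]
    field_simp
    ring
  have hLg : ∀ᵐ h ∂Q, L h ≤ n * realBkl (s h) (r h) := by
    have hs0' : ∀ᵐ h ∂Q, q = 0 → s h = 0 := by
      by_cases hq0 : q = 0
      · filter_upwards [hs0 hq0] with h hh _ using hh
      · exact Filter.Eventually.of_forall fun h hh => absurd hh hq0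
    have hs1' : ∀ᵐ h ∂Q, q = 1 → s h = 1 := by
      by_cases hq0 : q = 1
      · filter_upwards [hs1 hq0] with h hh _ using hh
      · exact Filter.Eventually.of_forall fun h hh => absurd hh hq0
    filter_upwards [hs0', hs1', hQP.ae_le h0, hQP.ae_le h1] with h a0 a1 b0 b1
    refine mul_le_mul_of_nonneg_left (add_le_add ?_ ?_) hn.le
    · refine mul_log_tangent_le (hs01 h).1 (hr01 h).1 (div_nonneg hq.1 hp0.le) b0 fun hu => a0 ?_
      simpa [hp0.ne'] using hu
    · refine mul_log_tangent_le (sub_nonneg.2 (hs01 h).2) (sub_nonneg.2 (hr01 h).2)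
        (div_nonneg hq1 hp1.le) (fun hb => ?_) fun hu => ?_
      · linarith [b1 (by linarith)]
      · rw [_root_.div_eq_zero_iff, or_iff_left hp1.ne'] at hu
        linarith [a1 (by linarith)]
  rw [← hLint]
  exact integral_le_integral_llr_add_log hQP hllr hLi
    ((measurable_realBkl.comp (hs.prodMk hr)).const_mul n) hLg hc hM

end changeOfMeasure

section empiricalRisk

variable {H Z : Type*} [MeasurableSpace H] [MeasurableSpace Z] {μ : Measure Z}
  [IsProbabilityMeasure μ]

lemma ae_mean_eq_of_ae_eq {N : ℕ} (hN : 0 < N) {g : Z → ℝ} {c : ℝ} (hg : ∀ᵐ z ∂μ, g z = c) :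
    ∀ᵐ S ∂(Measure.pi fun _ : Fin N => μ), (N : ℝ)⁻¹ * ∑ i, g (S i) = c := by
  have h : ∀ᵐ S ∂(Measure.pi fun _ : Fin N => μ), ∀ i, g (S i) = c :=
    ae_all_iff.2 fun i =>
      (Measure.quasiMeasurePreserving_eval (μ := fun _ : Fin N => μ) i).ae hg
  filter_upwards [h] with S hS
  have hN0 : (N : ℝ) ≠ 0 := by exact_mod_cast hN.ne'
  simp [hS, hN0]

lemma mean_mem_Icc {N : ℕ} {x : Fin N → ℝ} (hx : ∀ i, x i ∈ Set.Icc (0 : ℝ) 1) :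
    (N : ℝ)⁻¹ * ∑ i, x i ∈ Set.Icc (0 : ℝ) 1 := by
  refine ⟨mul_nonneg (by positivity) (Finset.sum_nonneg fun i _ => (hx i).1), ?_⟩
  rw [← div_eq_inv_mul]
  refine div_le_one_of_le₀ ?_ (Nat.cast_nonneg N)
  simpa using Finset.sum_le_sum (s := Finset.univ) fun i _ => (hx i).2

variable {f : H → Z → ℝ}

lemma measurable_integral_right (hf : Measurable fun p : H × Z => f p.1 p.2) :
    Measurable fun h => ∫ z, f h z ∂μ :=
  (StronglyMeasurable.integral_prod_right' (f := fun p : H × Z => f p.1 p.2)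
    hf.stronglyMeasurable).measurable

lemma measurable_mean (hf : Measurable fun p : H × Z => f p.1 p.2) (N : ℕ) :
    Measurable fun p : (Fin N → Z) × H => (N : ℝ)⁻¹ * ∑ i, f p.2 (p.1 i) := by
  refine measurable_const.mul (Finset.measurable_fun_sum _ fun i _ => ?_)
  exact hf.comp (measurable_snd.prodMk ((measurable_pi_apply i).comp measurable_fst))

lemma ae_ae_mean_eq_of_integral_eq (hf : Measurable fun p : H × Z => f p.1 p.2)
    (hf01 : ∀ h z, f h z ∈ Set.Icc (0 : ℝ) 1) {N : ℕ} (hN : 0 < N) (P : Measure H) [SFinite P]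
    {c : ℝ} (hc : c = 0 ∨ c = 1) :
    ∀ᵐ S ∂(Measure.pi fun _ : Fin N => μ), ∀ᵐ h ∂P,
      ∫ z, f h z ∂μ = c → (N : ℝ)⁻¹ * ∑ i, f h (S i) = c := by
  have hset : MeasurableSet {p : (Fin N → Z) × H |
      ∫ z, f p.2 z ∂μ = c → (N : ℝ)⁻¹ * ∑ i, f p.2 (p.1 i) = c} :=
    (measurableSet_eq_fun ((measurable_integral_right hf).comp measurable_snd)
      measurable_const).imp (measurableSet_eq_fun (measurable_mean hf N) measurable_const)
  rw [Measure.ae_ae_comm hset]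
  refine Filter.Eventually.of_forall fun h => ?_
  by_cases hr : ∫ z, f h z ∂μ = c
  · have hfh : Measurable (f h) := hf.comp measurable_prodMk_left
    have hae : ∀ᵐ z ∂μ, f h z = c := by
      rcases hc with rfl | rfl
      · exact ae_eq_zero_of_integral_eq_zero hfh (hf01 h) hr
      · exact ae_eq_one_of_integral_eq_one hfh (hf01 h) hr
    filter_upwards [ae_mean_eq_of_ae_eq hN hae] with S hS _ using hS
  · exact Filter.Eventually.of_forall fun S h' => absurd h' hr

variable (μ f) in
/-- The exponential moment of `N · kl` between empirical and true risk under the prior `P`. -/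
noncomputable def priorMoment (N : ℕ) (P : Measure H) (S : Fin N → Z) : ℝ≥0∞ :=
  ∫⁻ h, ENNReal.ofReal (Real.exp (N * realBkl ((N : ℝ)⁻¹ * ∑ i, f h (S i)) (∫ z, f h z ∂μ))) ∂P

lemma measurable_priorMoment_integrand (hf : Measurable fun p : H × Z => f p.1 p.2) (N : ℕ) :
    Measurable fun p : (Fin N → Z) × H => ENNReal.ofReal (Real.exp (N * realBkl
      ((N : ℝ)⁻¹ * ∑ i, f p.2 (p.1 i)) (∫ z, f p.2 z ∂μ))) := by
  have h := measurable_realBkl.comp ((measurable_mean hf N).prodMk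
    ((measurable_integral_right (μ := μ) hf).comp measurable_snd))
  exact (Real.measurable_exp.comp (h.const_mul _)).ennreal_ofReal

lemma lintegral_priorMoment_le (hf : Measurable fun p : H × Z => f p.1 p.2)
    (hf01 : ∀ h z, f h z ∈ Set.Icc (0 : ℝ) 1) {N : ℕ} (hN : 0 < N) (P : Measure H)
    [IsProbabilityMeasure P] :
    ∫⁻ S, priorMoment μ f N P S ∂(Measure.pi fun _ => μ) ≤ ENNReal.ofReal (2 * √N) := by
  unfold priorMoment
  rw [lintegral_lintegral_swap (measurable_priorMoment_integrand hf N).aemeasurable]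
  calc _ ≤ ∫⁻ _ : H, ENNReal.ofReal (2 * √N) ∂P := lintegral_mono fun h =>
        lintegral_exp_realBkl_mean_le μ N hN (hf.comp measurable_prodMk_left) (hf01 h)
    _ = _ := by simp

lemma measure_le_priorMoment (hf : Measurable fun p : H × Z => f p.1 p.2)
    (hf01 : ∀ h z, f h z ∈ Set.Icc (0 : ℝ) 1) {N : ℕ} (hN : 0 < N) (P : Measure H)
    [IsProbabilityMeasure P] {a : ℝ} (ha : 0 < a) :
    (Measure.pi fun _ => μ) {S | ENNReal.ofReal (2 * √N / a) ≤ priorMoment μ f N P S} ≤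
      ENNReal.ofReal a := by
  have hb : 0 < 2 * √(N : ℝ) := by positivity
  have hmeas : Measurable fun S => priorMoment μ f N P S :=
    (measurable_priorMoment_integrand hf N).lintegral_prod_right'
  refine (meas_ge_le_lintegral_div hmeas.aemeasurable
    (ENNReal.ofReal_pos.2 (by positivity)).ne' ENNReal.ofReal_ne_top).trans ?_
  calc _ ≤ ENNReal.ofReal (2 * √N) / ENNReal.ofReal (2 * √N / a) := by
        gcongr
        exact lintegral_priorMoment_le hf hf01 hN P
    _ = ENNReal.ofReal a := by
        rw [← ENNReal.ofReal_div_of_pos (by positivity)]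
        congr 1
        field_simp

/-- Outside the exceptional events the bound holds for every posterior. -/
lemma risk_le_klInv_of_priorMoment_lt (hf : Measurable fun p : H × Z => f p.1 p.2)
    (hf01 : ∀ h z, f h z ∈ Set.Icc (0 : ℝ) 1) {N : ℕ} (hN : 0 < N) {P : Measure H}
    [IsProbabilityMeasure P] {w : ℝ≥0∞} (hw : w ≤ 1) {δ : ℝ} (hδ : 0 < δ) {S : Fin N → Z}
    (hS : w ≠ 0 → priorMoment μ f N P S < ENNReal.ofReal (2 * √N / (δ * w.toReal)))
    (h0 : ∀ᵐ h ∂P, ∫ z, f h z ∂μ = 0 → (N : ℝ)⁻¹ * ∑ i, f h (S i) = 0)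
    (h1 : ∀ᵐ h ∂P, ∫ z, f h z ∂μ = 1 → (N : ℝ)⁻¹ * ∑ i, f h (S i) = 1)
    (Q : Measure H) [IsProbabilityMeasure Q] :
    ∫ h, ∫ z, f h z ∂μ ∂Q ≤ klInv (∫ h, (N : ℝ)⁻¹ * ∑ i, f h (S i) ∂Q)
      ((klDiv Q P + (if w = 0 then ⊤ else ENNReal.ofReal (Real.log (1 / w.toReal)))
        + ENNReal.ofReal (Real.log (2 * √N / δ))) / (N : ℝ≥0∞)) := by
  have hN0 : (0 : ℝ) < N := by exact_mod_cast hN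
  have hr : Measurable fun h => ∫ z, f h z ∂μ := measurable_integral_right hf
  have hr01 : ∀ h, ∫ z, f h z ∂μ ∈ Set.Icc (0 : ℝ) 1 := fun h =>
    integral_mem_Icc (hf.comp measurable_prodMk_left) (hf01 h)
  have htop : ∀ q : ℝ, ∫ h, ∫ z, f h z ∂μ ∂Q ≤ klInv q (⊤ / (N : ℝ≥0∞)) := fun q =>
    le_klInv (integral_mem_Icc hr hr01)
      (by rw [ENNReal.top_div_of_ne_top (ENNReal.natCast_ne_top N)]; exact le_top)
  by_cases hw0 : w = 0
  · simpa [hw0] using htop _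
  rw [if_neg hw0, klDiv]
  split_ifs with hQ
  swap
  · simpa using htop _
  have hw1 : w ≠ ⊤ := (hw.trans_lt ENNReal.one_lt_top).ne
  have hw2 : 0 < w.toReal := ENNReal.toReal_pos hw0 hw1
  have hs : Measurable fun h => (N : ℝ)⁻¹ * ∑ i, f h (S i) :=
    (measurable_mean hf N).comp measurable_prodMk_left
  have hs01 : ∀ h, (N : ℝ)⁻¹ * ∑ i, f h (S i) ∈ Set.Icc (0 : ℝ) 1 := fun h =>
    mean_mem_Icc fun i => hf01 h (S i)
  have hb : 0 < 2 * √(N : ℝ) := by positivity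
  have h := integral_le_klInv hQ.1 hQ.2 hs hr hs01 hr01 h0 h1 hN0
    (show 0 < 2 * √N / (δ * w.toReal) by positivity) (hS hw0).le
  refine h.trans (csSup_le_csSup ⟨1, fun _ hx => hx.1.2⟩ ?_ fun x hx => ⟨hx.1, hx.2.trans ?_⟩)
  · exact ⟨_, integral_mem_Icc (Q := Q) hs hs01, by simp [bkl]⟩
  have hlog : Real.log (2 * √N / (δ * w.toReal)) =
      Real.log (1 / w.toReal) + Real.log (2 * √N / δ) := by
    rw [← Real.log_mul (by positivity) (by positivity)]
    congr 1
    field_simp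
  rw [hlog, ENNReal.ofReal_div_of_pos hN0, ENNReal.ofReal_natCast, ← add_assoc]
  gcongr
  exact ENNReal.ofReal_add_le.trans (by gcongr; exact ENNReal.ofReal_add_le)

end empiricalRisk

/-- **PAC-Bayesian bound with countably many priors.** With probability at least `1 − δ`
over `S ∼ μ^N`, simultaneously for all `θ ∈ Θ` and all probability measures `Q`:
`R(Q) ≤ kl⁻¹(R_S(Q), (KL(Q‖P^θ) + ln(1/p_θ) + ln(2√N/δ))/N)`. -/
theorem pac_bayes_countable_priors
    {H X Y : Type*} [MeasurableSpace H] [MeasurableSpace X] [MeasurableSpace Y]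
    (ev : H → X → Y) (hev : Measurable fun p : H × X => ev p.1 p.2)
    (ℓ : Y → Y → ℝ) (hℓ : Measurable fun p : Y × Y => ℓ p.1 p.2)
    (hℓ01 : ∀ y y', ℓ y y' ∈ Set.Icc (0 : ℝ) 1)
    (μ : Measure (X × Y)) [IsProbabilityMeasure μ]
    (N : ℕ) (hN : 0 < N)
    {Θ : Type*} [Countable Θ] (pθ : Θ → ℝ≥0∞) (hpθ : ∑' θ, pθ θ = 1)
    (P : Θ → Measure H) (hP : ∀ θ, IsProbabilityMeasure (P θ))
    (δ : ℝ) (hδ : 0 < δ) (hδ1 : δ ≤ 1) :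
    ENNReal.ofReal (1 - δ) ≤
      (Measure.pi fun _ : Fin N => μ)
        {S | ∀ (θ : Θ) (Q : Measure H), IsProbabilityMeasure Q →
          (∫ h, ∫ z, ℓ z.2 (ev h z.1) ∂μ ∂Q) ≤
            klInv (∫ h, (N : ℝ)⁻¹ * ∑ i : Fin N, ℓ (S i).2 (ev h (S i).1) ∂Q)
              ((klDiv Q (P θ)
                  + (if pθ θ = 0 then ⊤ else ENNReal.ofReal (Real.log (1 / (pθ θ).toReal)))
                  + ENNReal.ofReal (Real.log (2 * Real.sqrt N / δ))) / (N : ℝ≥0∞))} := by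
  let f : H → X × Y → ℝ := fun h z => ℓ z.2 (ev h z.1)
  have hf : Measurable fun p : H × (X × Y) => f p.1 p.2 :=
    hℓ.comp ((measurable_snd.comp measurable_snd).prodMk
      (hev.comp (measurable_fst.prodMk (measurable_fst.comp measurable_snd))))
  have hf01 : ∀ h z, f h z ∈ Set.Icc (0 : ℝ) 1 := fun h z => hℓ01 _ _
  have hw : ∀ θ, pθ θ ≤ 1 := fun θ => hpθ ▸ ENNReal.le_tsum θ
  set π : Measure (Fin N → X × Y) := Measure.pi fun _ => μ with hπ
  let B : Θ → Set (Fin N → X × Y) := fun θ =>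
    {S | pθ θ ≠ 0 ∧ ENNReal.ofReal (2 * √N / (δ * (pθ θ).toReal)) ≤ priorMoment μ f N (P θ) S}
  have hB : ∀ θ, π (B θ) ≤ ENNReal.ofReal δ * pθ θ := by
    intro θ
    by_cases hθ : pθ θ = 0
    · simp [B, hθ]
    have hθ1 : pθ θ ≠ ⊤ := ((hw θ).trans_lt ENNReal.one_lt_top).ne
    have hθ2 : 0 < (pθ θ).toReal := ENNReal.toReal_pos hθ hθ1
    calc _ ≤ ENNReal.ofReal (δ * (pθ θ).toReal) :=
          (measure_mono fun S hS => hS.2).trans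
            (measure_le_priorMoment hf hf01 hN (P θ) (mul_pos hδ hθ2))
      _ = _ := by rw [ENNReal.ofReal_mul hδ.le, ENNReal.ofReal_toReal hθ1]
  have hBU : π (⋃ θ, B θ) ≤ ENNReal.ofReal δ := by
    calc _ ≤ ∑' θ, π (B θ) := measure_iUnion_le B
      _ ≤ ∑' θ, ENNReal.ofReal δ * pθ θ := ENNReal.tsum_le_tsum hB
      _ = _ := by rw [ENNReal.tsum_mul_left, hpθ, mul_one]
  have hnull : ∀ᵐ S ∂π, ∀ θ, (∀ᵐ h ∂(P θ), ∫ z, f h z ∂μ = 0 → (N : ℝ)⁻¹ * ∑ i, f h (S i) = 0) ∧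
      ∀ᵐ h ∂(P θ), ∫ z, f h z ∂μ = 1 → (N : ℝ)⁻¹ * ∑ i, f h (S i) = 1 :=
    ae_all_iff.2 fun θ => (ae_ae_mean_eq_of_integral_eq hf hf01 hN (P θ) (Or.inl rfl)).and
      (ae_ae_mean_eq_of_integral_eq hf hf01 hN (P θ) (Or.inr rfl))
  have hcompl : 1 - ENNReal.ofReal δ ≤ π (⋃ θ, B θ)ᶜ := by
    rw [tsub_le_iff_right, ← measure_univ (μ := π), ← Set.compl_union_self (⋃ θ, B θ)]
    exact (measure_union_le _ _).trans (by gcongr)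
  rw [ENNReal.ofReal_sub _ hδ.le, ENNReal.ofReal_one]
  refine hcompl.trans (measure_mono_ae ?_)
  filter_upwards [hnull] with S hS hSB θ Q hQ
  refine risk_le_klInv_of_priorMoment_lt (f := f) hf hf01 hN (hw θ) hδ (fun hθ => ?_)
    (hS θ).1 (hS θ).2 Q
  exact lt_of_not_ge fun hle => hSB (Set.mem_iUnion.2 ⟨θ, hθ, hle⟩)
end

section
/- (Partial derivative of the inverse binary KL divergence in its first argument.) Fix ε ∈ (0,∞) and q ∈ (0,1), and let p := kl⁻¹(q,ε), so q < p < 1. Then the function q' ↦ kl⁻¹(q',ε) is differentiable at q with derivative ∂ kl⁻¹(q,ε)/∂q = ( ln((1−q)/(1−p)) − ln(q/p) ) / ( (1−q)/(1−p) − q/p ). -/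
open MeasureTheory ENNReal NNReal
open scoped Classical

open Set Filter Topology

/-- The real-valued formula for the binary KL divergence with both arguments in `(0, 1)`. -/
noncomputable def bklReal (q p : ℝ) : ℝ :=
  q * Real.log (q / p) + (1 - q) * Real.log ((1 - q) / (1 - p))

theorem bkl_eq_ofReal_bklReal {q p : ℝ} (hqp : q < p) (hp0 : 0 < p) (hp1 : p < 1) :
    bkl q p = ENNReal.ofReal (bklReal q p) := by
  rw [bkl, if_neg hqp.ne, if_neg (by simp [hp0.ne', hp1.ne]), bklReal]

theorem bklReal_self {q : ℝ} (hq0 : 0 < q) (hq1 : q < 1) : bklReal q q = 0 := by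
  simp [bklReal, hq0.ne', (sub_pos.2 hq1).ne']

theorem sub_div_sub_pos {q p : ℝ} (hq0 : 0 < q) (hqp : q < p) (hp1 : p < 1) :
    0 < (1 - q) / (1 - p) - q / p := by
  have h1 : q / p < 1 := (div_lt_one (hq0.trans hqp)).2 hqp
  have h2 : 1 < (1 - q) / (1 - p) := (one_lt_div (sub_pos.2 hp1)).2 (by linarith)
  linarith

theorem hasStrictFDerivAt_bklReal {q p : ℝ} (hq0 : 0 < q) (hq1 : q < 1)
    (hp0 : 0 < p) (hp1 : p < 1) :
    HasStrictFDerivAt (fun v : ℝ × ℝ => bklReal v.1 v.2)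
      ((Real.log (q / p) - Real.log ((1 - q) / (1 - p))) • ContinuousLinearMap.fst ℝ ℝ ℝ +
        ((1 - q) / (1 - p) - q / p) • ContinuousLinearMap.snd ℝ ℝ ℝ) (q, p) := by
  have hq1' : 1 - q ≠ 0 := (sub_pos.2 hq1).ne'
  have hp1' : 1 - p ≠ 0 := (sub_pos.2 hp1).ne'
  have hf : HasStrictFDerivAt (fun v : ℝ × ℝ => v.1) (ContinuousLinearMap.fst ℝ ℝ ℝ) (q, p) :=
    hasStrictFDerivAt_fst
  have hs : HasStrictFDerivAt (fun v : ℝ × ℝ => v.2) (ContinuousLinearMap.snd ℝ ℝ ℝ) (q, p) :=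
    hasStrictFDerivAt_snd
  have hf' := hf.const_sub 1
  have hs' := hs.const_sub 1
  have key := (hf.mul ((hf.log hq0.ne').sub (hs.log hp0.ne'))).add
    (hf'.mul ((hf'.log hq1').sub (hs'.log hp1')))
  refine (key.congr_fderiv ?_).congr_of_eventuallyEq ?_
  · rw [Real.log_div hq0.ne' hp0.ne', Real.log_div hq1' hp1']
    ext <;> simp <;> field_simp <;> ring
  · have e1 : ∀ᶠ v : ℝ × ℝ in 𝓝 (q, p), v.1 ∈ Ioo (0 : ℝ) 1 :=
      continuous_fst.continuousAt.eventually (Ioo_mem_nhds hq0 hq1)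
    have e2 : ∀ᶠ v : ℝ × ℝ in 𝓝 (q, p), v.2 ∈ Ioo (0 : ℝ) 1 :=
      continuous_snd.continuousAt.eventually (Ioo_mem_nhds hp0 hp1)
    filter_upwards [e1, e2] with v h1 h2
    simp only [bklReal, Pi.mul_apply, Pi.add_apply, Pi.sub_apply]
    rw [Real.log_div h1.1.ne' h2.1.ne',
      Real.log_div (sub_pos.2 h1.2).ne' (sub_pos.2 h2.2).ne']

theorem hasDerivAt_bklReal_right {q p : ℝ} (hq0 : 0 < q) (hq1 : q < 1)
    (hp0 : 0 < p) (hp1 : p < 1) :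
    HasDerivAt (bklReal q) ((1 - q) / (1 - p) - q / p) p := by
  have h := (hasStrictFDerivAt_bklReal hq0 hq1 hp0 hp1).hasFDerivAt.comp_hasDerivAt p
    ((hasDerivAt_const p q).prodMk (hasDerivAt_id p))
  simpa [Function.comp_def] using! h

theorem continuousOn_bklReal_right {q : ℝ} (hq0 : 0 < q) (hq1 : q < 1) :
    ContinuousOn (bklReal q) (Ico q 1) := fun _ hx =>
  (hasDerivAt_bklReal_right hq0 hq1 (hq0.trans_le hx.1) hx.2).continuousAt.continuousWithinAt

theorem strictMonoOn_bklReal_right {q : ℝ} (hq0 : 0 < q) (hq1 : q < 1) :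
    StrictMonoOn (bklReal q) (Ico q 1) := by
  refine strictMonoOn_of_deriv_pos (convex_Ico q 1) (continuousOn_bklReal_right hq0 hq1) ?_
  intro x hx
  rw [interior_Ico] at hx
  rw [(hasDerivAt_bklReal_right hq0 hq1 (hq0.trans hx.1) hx.2).deriv]
  exact sub_div_sub_pos hq0 hx.1 hx.2

theorem exists_bklReal_eq {q ε : ℝ} (hq0 : 0 < q) (hq1 : q < 1) (hε : 0 < ε) :
    ∃ p ∈ Ioo q 1, bklReal q p = ε := by
  have hq1' : 0 < 1 - q := sub_pos.2 hq1
  have hlq : q * Real.log q < 0 := mul_neg_of_pos_of_neg hq0 (Real.log_neg hq0 hq1)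
  obtain ⟨t, ht⟩ : ∃ t, t = (ε - q * Real.log q) / (1 - q) := ⟨_, rfl⟩
  have ht0 : 0 < t := ht ▸ div_pos (by linarith) hq1'
  have hexp : Real.exp (-t) < 1 := Real.exp_lt_one_iff.2 (by linarith)
  obtain ⟨b, hb⟩ : ∃ b, b = 1 - (1 - q) * Real.exp (-t) := ⟨_, rfl⟩
  have hb1 : b < 1 := by
    have := mul_pos hq1' (Real.exp_pos (-t))
    linarith
  have hqb : q < b := by nlinarith
  have hb0 : 0 < b := hq0.trans hqb
  have hlb : q * Real.log b < 0 := mul_neg_of_pos_of_neg hq0 (Real.log_neg hb0 hb1)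
  have hεb : ε ≤ bklReal q b := by
    have h1 : (1 - q) / (1 - b) = Real.exp t := by
      rw [hb, _root_.sub_sub_cancel, Real.exp_neg]
      field_simp
    have h2 : (1 - q) * t = ε - q * Real.log q := by
      rw [ht]
      field_simp
    rw [bklReal, h1, Real.log_exp, h2, Real.log_div hq0.ne' hb0.ne']
    linarith
  obtain ⟨p, hp, hpε⟩ := intermediate_value_Icc hqb.le
    ((continuousOn_bklReal_right hq0 hq1).mono (Icc_subset_Ico_right hb1))
    ⟨(bklReal_self hq0 hq1).trans_le hε.le, hεb⟩
  refine ⟨p, ⟨hp.1.lt_of_ne ?_, hp.2.trans_lt hb1⟩, hpε⟩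
  rintro rfl
  exact hε.ne (by rw [← hpε, bklReal_self hq0 hq1])

theorem klInv_eq_of_bklReal_eq {q p ε : ℝ} (hq0 : 0 < q) (hqp : q < p) (hp1 : p < 1)
    (hε : 0 < ε) (h : bklReal q p = ε) : klInv q (ENNReal.ofReal ε) = p := by
  have hp0 := hq0.trans hqp
  refine IsGreatest.csSup_eq ⟨⟨⟨hp0.le, hp1.le⟩, ?_⟩, ?_⟩
  · rw [bkl_eq_ofReal_bklReal hqp hp0 hp1, h]
  · rintro x ⟨⟨_, hx1⟩, hx⟩
    by_contra! hpx
    rcases hx1.eq_or_lt with rfl | hx1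
    · simp [bkl, (hqp.trans hpx).ne] at hx
    · rw [bkl_eq_ofReal_bklReal (hqp.trans hpx) (hp0.trans hpx) hx1,
        ENNReal.ofReal_le_ofReal_iff hε.le, ← h] at hx
      exact hx.not_gt (strictMonoOn_bklReal_right hq0 (hqp.trans hp1)
        ⟨hqp.le, hp1⟩ ⟨(hqp.trans hpx).le, hx1⟩ hpx)

/-- **Partial derivative of the inverse binary KL divergence in its first argument.**
For `q ∈ (0,1)` and `ε ∈ (0,∞)`, with `p := kl⁻¹(q,ε)` one has `q < p < 1` and
`∂ kl⁻¹(q,ε)/∂q = (ln((1−q)/(1−p)) − ln(q/p)) / ((1−q)/(1−p) − q/p)`. -/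
theorem klInv_hasDerivAt_first (q ε : ℝ) (hq : q ∈ Set.Ioo (0 : ℝ) 1) (hε : 0 < ε)
    (p : ℝ) (hp : p = klInv q (ENNReal.ofReal ε)) :
    q < p ∧ p < 1 ∧
    HasDerivAt (fun q' => klInv q' (ENNReal.ofReal ε))
      ((Real.log ((1 - q) / (1 - p)) - Real.log (q / p)) /
        ((1 - q) / (1 - p) - q / p)) q := by
  obtain ⟨hq0, hq1⟩ := hq
  obtain ⟨r, ⟨hqr, hr1⟩, hr⟩ := exists_bklReal_eq hq0 hq1 hε
  obtain rfl : p = r := hp.trans (klInv_eq_of_bklReal_eq hq0 hqr hr1 hε hr)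
  refine ⟨hqr, hr1, ?_⟩
  have hF := hasStrictFDerivAt_bklReal hq0 hq1 (hq0.trans hqr) hr1
  have hb := sub_div_sub_pos hq0 hqr hr1
  set a := Real.log (q / p) - Real.log ((1 - q) / (1 - p)) with ha
  set b := (1 - q) / (1 - p) - q / p
  have hinr : (a • ContinuousLinearMap.fst ℝ ℝ ℝ + b • ContinuousLinearMap.snd ℝ ℝ ℝ) ∘L
      .inr ℝ ℝ ℝ = (ContinuousLinearEquiv.smulLeft (Units.mk0 b hb.ne') : ℝ ≃L[ℝ] ℝ) := by
    ext
    simp [Units.smul_def]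
  have hinv : ((a • ContinuousLinearMap.fst ℝ ℝ ℝ + b • ContinuousLinearMap.snd ℝ ℝ ℝ) ∘L
      .inr ℝ ℝ ℝ).IsInvertible := ⟨_, hinr.symm⟩
  have hlim := hF.tendsto_implicitFunctionOfProdDomain hinv
  have hψ := (hF.hasStrictFDerivAt_implicitFunctionOfProdDomain hinv).hasFDerivAt.hasDerivAt
  have heq := hF.eventually_apply_implicitFunctionOfProdDomain hinv
  set ψ := hF.implicitFunctionOfProdDomain hinv
  have hagree : (fun q' => klInv q' (ENNReal.ofReal ε)) =ᶠ[𝓝 q] ψ := by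
    filter_upwards [heq, hlim.eventually_lt_const hr1, tendsto_id.eventually_lt hlim hqr,
      lt_mem_nhds hq0] with x hx hx1 hxψ hx0
    exact klInv_eq_of_bklReal_eq hx0 hxψ hx1 hε (hx.trans hr)
  refine (hψ.congr_of_eventuallyEq hagree).congr_deriv ?_
  have hsymm (x : ℝ) :
      (ContinuousLinearEquiv.smulLeft (Units.mk0 b hb.ne') : ℝ ≃L[ℝ] ℝ).symm x = x / b := by
    rw [ContinuousLinearEquiv.symm_apply_eq]
    simp [Units.smul_def, mul_div_cancel₀, hb.ne']
  have hval : -(a / b) = (Real.log ((1 - q) / (1 - p)) - Real.log (q / p)) / b := by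
    rw [ha, ← neg_div, neg_sub]
  simpa [hinr, ContinuousLinearMap.inverse_equiv, hsymm] using! hval
end

section
/- (KL divergence between the GP-regression posterior and prior marginals.) Let N be a positive natural number, y, m ∈ ℝ^N, σ_n > 0, and let K ∈ ℝ^{N×N} be symmetric positive definite. Let Q = N( m + K(K + σ_n² I)⁻¹(y − m), K − K(K + σ_n² I)⁻¹K ) and P = N(m, K) be Gaussian measures on ℝ^N (the posterior covariance K − K(K+σ_n²I)⁻¹K = σ_n² K (K+σ_n² I)⁻¹ is positive definite). Then KL(Q‖P) = (1/2) ln det(K + σ_n² I) − (N/2) ln σ_n² − (1/2) tr( K (K + σ_n² I)⁻¹ ) + (1/2) (y − m)ᵀ (K + σ_n² I)⁻¹ K (K + σ_n² I)⁻¹ (y − m). -/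
open MeasureTheory Matrix ENNReal NNReal
open scoped Classical

/-- The multivariate Gaussian measure `N(a, B)` on `ℝ^M`, given by the density
`(2π)^{−M/2} det(B)^{−1/2} exp(−(1/2)(x−a)ᵀ B⁻¹ (x−a))` with respect to Lebesgue measure. -/
noncomputable def mvGaussian {M : ℕ} (a : Fin M → ℝ) (B : Matrix (Fin M) (Fin M) ℝ) :
    Measure (Fin M → ℝ) :=
  volume.withDensity fun x =>
    ENNReal.ofReal ((2 * Real.pi) ^ (-(M : ℝ) / 2) * B.det ^ (-(1 : ℝ) / 2) *
      Real.exp (-(1 / 2) * ((x - a) ⬝ᵥ B⁻¹ *ᵥ (x - a))))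

section Moments

open ProbabilityTheory

/-- A product of measures on `ℝ` with real densities has the product density. -/
lemma pi_withDensity_ofReal {ι : Type*} [Fintype ι] {p : ℝ → ℝ} (hp : Integrable p)
    (hp0 : ∀ x, 0 ≤ p x)
    [SigmaFinite ((volume : Measure ℝ).withDensity fun x => ENNReal.ofReal (p x))] :
    Measure.pi (fun _ : ι => (volume : Measure ℝ).withDensity fun x => ENNReal.ofReal (p x)) =
      (volume : Measure (ι → ℝ)).withDensity fun x => ENNReal.ofReal (∏ i, p (x i)) := by
  refine Measure.pi_eq fun s hs => ?_
  rw [withDensity_apply _ (MeasurableSet.univ_pi hs), volume_pi, Measure.restrict_pi_pi,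
    ← ofReal_integral_eq_lintegral_ofReal, integral_fintype_prod_eq_prod (fun _ => p)
      (μ := fun i => (volume : Measure ℝ).restrict (s i)),
    ENNReal.ofReal_prod_of_nonneg fun i _ => integral_nonneg hp0]
  · refine Finset.prod_congr rfl fun i _ => ?_
    rw [withDensity_apply _ (hs i), ofReal_integral_eq_lintegral_ofReal hp.restrict
      (Filter.Eventually.of_forall hp0)]
  · exact Integrable.fintype_prod (f := fun _ => p)
      (μ := fun i => (volume : Measure ℝ).restrict (s i)) fun i => hp.restrict
  · exact Filter.Eventually.of_forall fun x => Finset.prod_nonneg fun i _ => hp0 _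

lemma pi_gaussianReal_eq_mvGaussian (M : ℕ) :
    Measure.pi (fun _ : Fin M => gaussianReal 0 1) = mvGaussian (M := M) 0 1 := by
  have h : gaussianReal 0 1 =
      (volume : Measure ℝ).withDensity fun x => ENNReal.ofReal (gaussianPDFReal 0 1 x) :=
    gaussianReal_of_var_ne_zero 0 one_ne_zero
  have : SigmaFinite ((volume : Measure ℝ).withDensity
      fun x => ENNReal.ofReal (gaussianPDFReal 0 1 x)) := h ▸ inferInstance
  rw [h, pi_withDensity_ofReal (integrable_gaussianPDFReal 0 1) (gaussianPDFReal_nonneg 0 1),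
    mvGaussian]
  congr 1
  ext x
  congr 1
  simp only [gaussianPDFReal, Finset.prod_mul_distrib, Finset.prod_const, ← Real.exp_sum,
    Finset.card_univ, Fintype.card_fin, det_one, Real.one_rpow, mul_one, NNReal.coe_one, sub_zero,
    inv_one, one_mulVec]
  congr 1
  · rw [Real.sqrt_eq_rpow, ← Real.rpow_neg (by positivity), ← Real.rpow_natCast,
      ← Real.rpow_mul (by positivity)]
    congr 1
    ring
  · rw [dotProduct, Finset.mul_sum]
    congr 1
    refine Finset.sum_congr rfl fun i _ => ?_
    ring

/-- An invertible affine image of a standard Gaussian vector is Gaussian. -/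
lemma map_affine_mvGaussian {M : ℕ} (b : Fin M → ℝ) {A S : Matrix (Fin M) (Fin M) ℝ}
    (hA : A * Aᵀ = S) (hdet : A.det ≠ 0) :
    (mvGaussian 0 1).map (fun z => b + A *ᵥ z) = mvGaussian b S := by
  have hT : Measurable fun z : Fin M → ℝ => b + A *ᵥ z :=
    (Continuous.measurable (by fun_prop))
  have hunit : IsUnit A.det := hdet.isUnit
  have hmap : (volume : Measure (Fin M → ℝ)).map (fun z => b + A *ᵥ z) =
      ENNReal.ofReal |A.det⁻¹| • volume := by
    have h := Real.map_matrix_volume_pi_eq_smul_volume_pi hdet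
    have hcomp : (fun z : Fin M → ℝ => b + A *ᵥ z) = (fun x => b + x) ∘ (toLin' A) := by
      ext z; simp
    rw [hcomp, ← Measure.map_map (by fun_prop) (Continuous.measurable (by fun_prop)), h,
      Measure.map_smul, map_add_left_eq_self]
  have hSdet : S.det = A.det ^ 2 := by rw [← hA, det_mul, det_transpose, sq]
  have hSinv : S⁻¹ = A⁻¹ᵀ * A⁻¹ := by
    rw [← hA, Matrix.mul_inv_rev, transpose_nonsing_inv]
  have hquad : ∀ z, ((b + A *ᵥ z - b) ⬝ᵥ S⁻¹ *ᵥ (b + A *ᵥ z - b)) = z ⬝ᵥ z := fun z => by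
    rw [add_sub_cancel_left, hSinv, ← mulVec_mulVec, mulVec_mulVec _ A⁻¹, nonsing_inv_mul _ hunit,
      one_mulVec, mulVec_transpose, dotProduct_comm, ← dotProduct_mulVec, mulVec_mulVec,
      nonsing_inv_mul _ hunit, one_mulVec]
  ext s hs
  have hmeas : Measurable fun x : Fin M → ℝ =>
      ENNReal.ofReal |A.det| * ENNReal.ofReal ((2 * Real.pi) ^ (-(M : ℝ) / 2) *
        S.det ^ (-(1 : ℝ) / 2) * Real.exp (-(1 / 2) * ((x - b) ⬝ᵥ S⁻¹ *ᵥ (x - b)))) := by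
    refine Measurable.const_mul (ENNReal.measurable_ofReal.comp (Continuous.measurable ?_)) _
    fun_prop
  have hlhs : (fun x : Fin M → ℝ => ENNReal.ofReal ((2 * Real.pi) ^ (-(M : ℝ) / 2) *
      (1 : Matrix (Fin M) (Fin M) ℝ).det ^ (-(1 : ℝ) / 2) *
      Real.exp (-(1 / 2) * ((x - 0) ⬝ᵥ (1 : Matrix (Fin M) (Fin M) ℝ)⁻¹ *ᵥ (x - 0))))) =
      fun z => ENNReal.ofReal |A.det| * ENNReal.ofReal ((2 * Real.pi) ^ (-(M : ℝ) / 2) *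
        S.det ^ (-(1 : ℝ) / 2) *
        Real.exp (-(1 / 2) * ((b + A *ᵥ z - b) ⬝ᵥ S⁻¹ *ᵥ (b + A *ᵥ z - b)))) := by
    ext z
    rw [hquad, ← ENNReal.ofReal_mul (abs_nonneg _), hSdet]
    congr 1
    have h2 : (A.det ^ 2) ^ (-(1 : ℝ) / 2) = |A.det|⁻¹ := by
      rw [← sq_abs, ← Real.rpow_natCast, ← Real.rpow_mul (abs_nonneg _), ← Real.rpow_neg_one]
      norm_num
    have h3 : |A.det| ≠ 0 := abs_ne_zero.2 hdet
    simp only [det_one, Real.one_rpow, sub_zero, inv_one, one_mulVec, h2]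
    field_simp
  rw [Measure.map_apply hT hs, mvGaussian, mvGaussian, withDensity_apply _ (hT hs),
    withDensity_apply _ hs, hlhs, ← setLIntegral_map hs hmeas hT, hmap, Measure.restrict_smul,
    lintegral_smul_measure, lintegral_const_mul' _ _ ENNReal.ofReal_ne_top, smul_eq_mul,
    ← mul_assoc, ← ENNReal.ofReal_mul (abs_nonneg _), ← abs_mul, inv_mul_cancel₀ hdet]
  simp

lemma mvGaussian_eq_map_multivariateGaussian {M : ℕ} (b : Fin M → ℝ)
    {S : Matrix (Fin M) (Fin M) ℝ} (hS : S.PosDef) :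
    mvGaussian b S = (multivariateGaussian (WithLp.toLp 2 b) S).map WithLp.ofLp := by
  open scoped MatrixOrder Matrix.Norms.L2Operator in
  have hsq : CFC.sqrt S * CFC.sqrt S = S := CFC.sqrt_mul_sqrt_self _ hS.posSemidef.nonneg
  open scoped MatrixOrder Matrix.Norms.L2Operator in
  have hsymm : (CFC.sqrt S)ᵀ = CFC.sqrt S := by
    simpa [conjTranspose_eq_transpose_of_trivial] using
      (CFC.sqrt_nonneg S).posSemidef.isHermitian.eq
  have hdet : (CFC.sqrt S).det ≠ 0 := fun h => by
    have := congrArg det hsq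
    rw [det_mul, h, zero_mul] at this
    exact hS.det_pos.ne this
  rw [← map_affine_mvGaussian b (A := CFC.sqrt S) (by rw [hsymm, hsq]) hdet,
    ← pi_gaussianReal_eq_mvGaussian, multivariateGaussian, ← map_pi_eq_stdGaussian,
    Measure.map_map (by fun_prop) (by fun_prop), Measure.map_map (by fun_prop) (by fun_prop)]
  congr 1

lemma isProbabilityMeasure_mvGaussian {M : ℕ} (b : Fin M → ℝ)
    {S : Matrix (Fin M) (Fin M) ℝ} (hS : S.PosDef) : IsProbabilityMeasure (mvGaussian b S) := by
  rw [mvGaussian_eq_map_multivariateGaussian b hS]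
  exact Measure.isProbabilityMeasure_map (by fun_prop)

lemma memLp_eval_mvGaussian {M : ℕ} (b : Fin M → ℝ) {S : Matrix (Fin M) (Fin M) ℝ}
    (hS : S.PosDef) (i : Fin M) : MemLp (fun x => x i) 2 (mvGaussian b S) := by
  rw [mvGaussian_eq_map_multivariateGaussian b hS,
    memLp_map_measure_iff (measurable_pi_apply (X := fun _ => ℝ) i).aestronglyMeasurable (by fun_prop)]
  exact (EuclideanSpace.proj (𝕜 := ℝ) i).comp_memLp' IsGaussian.memLp_two_id

lemma integral_eval_mvGaussian {M : ℕ} (b : Fin M → ℝ) {S : Matrix (Fin M) (Fin M) ℝ}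
    (hS : S.PosDef) (i : Fin M) : ∫ x, x i ∂mvGaussian b S = b i := by
  rw [mvGaussian_eq_map_multivariateGaussian b hS, integral_map (by fun_prop)
    (measurable_pi_apply (X := fun _ => ℝ) i).aestronglyMeasurable]
  have h := (EuclideanSpace.proj (𝕜 := ℝ) i).integral_comp_comm
    (IsGaussian.integrable_fun_id (μ := multivariateGaussian (WithLp.toLp 2 b) S))
  simpa using h

lemma covariance_eval_mvGaussian {M : ℕ} (b : Fin M → ℝ) {S : Matrix (Fin M) (Fin M) ℝ}
    (hS : S.PosDef) (i j : Fin M) :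
    cov[fun x => x i, fun x => x j; mvGaussian b S] = S i j := by
  rw [mvGaussian_eq_map_multivariateGaussian b hS, covariance_map
    (measurable_pi_apply (X := fun _ => ℝ) i).aestronglyMeasurable (measurable_pi_apply (X := fun _ => ℝ) j).aestronglyMeasurable
    (by fun_prop)]
  exact covariance_eval_multivariateGaussian hS.posSemidef i j

lemma integrable_mul_mvGaussian {M : ℕ} (b c : Fin M → ℝ) {S : Matrix (Fin M) (Fin M) ℝ}
    (hS : S.PosDef) (i j : Fin M) :
    Integrable (fun x => (x i - c i) * (x j - c j)) (mvGaussian b S) := by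
  have := isProbabilityMeasure_mvGaussian b hS
  exact ((memLp_eval_mvGaussian b hS i).sub (memLp_const (c i))).integrable_mul
    ((memLp_eval_mvGaussian b hS j).sub (memLp_const (c j)))

lemma integral_mul_mvGaussian {M : ℕ} (b c : Fin M → ℝ) {S : Matrix (Fin M) (Fin M) ℝ}
    (hS : S.PosDef) (i j : Fin M) :
    ∫ x, (x i - c i) * (x j - c j) ∂mvGaussian b S =
      S i j + (b i - c i) * (b j - c j) := by
  have := isProbabilityMeasure_mvGaussian b hS
  have hi := memLp_eval_mvGaussian b hS i
  have hj := memLp_eval_mvGaussian b hS j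
  have hic : MemLp (fun x => x i - c i) 2 (mvGaussian b S) := hi.sub (memLp_const (c i))
  have hjc : MemLp (fun x => x j - c j) 2 (mvGaussian b S) := hj.sub (memLp_const (c j))
  have h := covariance_eq_sub hic hjc
  rw [covariance_sub_const_left (hi.integrable one_le_two),
    covariance_sub_const_right (hj.integrable one_le_two), covariance_eval_mvGaussian b hS,
    integral_sub (hi.integrable one_le_two) (integrable_const _),
    integral_sub (hj.integrable one_le_two) (integrable_const _),
    integral_eval_mvGaussian b hS, integral_eval_mvGaussian b hS] at h
  simp only [integral_const, probReal_univ, one_smul, Pi.mul_apply] at h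
  linarith

lemma dotProduct_mulVec_eq_sum {M : ℕ} (C : Matrix (Fin M) (Fin M) ℝ) (u : Fin M → ℝ) :
    u ⬝ᵥ C *ᵥ u = ∑ i, ∑ j, C i j * (u i * u j) := by
  simp only [dotProduct, mulVec, Finset.mul_sum]
  exact Finset.sum_congr rfl fun i _ => Finset.sum_congr rfl fun j _ => by ring

lemma integrable_quadForm_mvGaussian {M : ℕ} (b c : Fin M → ℝ) {S : Matrix (Fin M) (Fin M) ℝ}
    (hS : S.PosDef) (C : Matrix (Fin M) (Fin M) ℝ) :
    Integrable (fun x => (x - c) ⬝ᵥ C *ᵥ (x - c)) (mvGaussian b S) := by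
  simp only [dotProduct_mulVec_eq_sum]
  exact integrable_finsetSum _ fun i _ => integrable_finsetSum _ fun j _ =>
    (integrable_mul_mvGaussian b c hS i j).const_mul _

/-- The expectation of a quadratic form of a Gaussian vector. -/
lemma integral_quadForm_mvGaussian {M : ℕ} (b c : Fin M → ℝ) {S : Matrix (Fin M) (Fin M) ℝ}
    (hS : S.PosDef) (C : Matrix (Fin M) (Fin M) ℝ) :
    ∫ x, (x - c) ⬝ᵥ C *ᵥ (x - c) ∂mvGaussian b S =
      (C * S).trace + (b - c) ⬝ᵥ C *ᵥ (b - c) := by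
  have hint : ∀ i j, Integrable (fun x : Fin M → ℝ => C i j * ((x - c) i * (x - c) j))
      (mvGaussian b S) := fun i j => (integrable_mul_mvGaussian b c hS i j).const_mul _
  simp only [dotProduct_mulVec_eq_sum]
  rw [integral_finsetSum _ fun i _ => integrable_finsetSum _ fun j _ => hint i j]
  have hrow : ∀ i, ∫ x, ∑ j, C i j * ((x - c) i * (x - c) j) ∂mvGaussian b S =
      ∑ j, C i j * (S i j + (b i - c i) * (b j - c j)) := fun i => by
    rw [integral_finsetSum _ fun j _ => hint i j]
    simp only [integral_const_mul, Pi.sub_apply, integral_mul_mvGaussian b c hS]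
  rw [Finset.sum_congr rfl fun i _ => hrow i]
  simp only [Pi.sub_apply, mul_add, Finset.sum_add_distrib]
  congr 1
  simp only [trace, diag_apply, mul_apply]
  refine Finset.sum_congr rfl fun i _ => Finset.sum_congr rfl fun j _ => ?_
  rw [← hS.isHermitian.apply i j, star_trivial]

end Moments

lemma withDensity_ofReal_absolutelyContinuous {α : Type*} [MeasurableSpace α] (μ : Measure α)
    {f g : α → ℝ} (hg : Measurable g) (hg0 : ∀ x, 0 < g x) :
    μ.withDensity (fun x => ENNReal.ofReal (f x)) ≪
      μ.withDensity fun x => ENNReal.ofReal (g x) :=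
  (withDensity_absolutelyContinuous _ _).trans <|
    withDensity_absolutelyContinuous' hg.ennreal_ofReal.aemeasurable
      (Filter.Eventually.of_forall fun x => by simpa using hg0 x)

/-- The log-likelihood ratio of two measures with positive real densities. -/
lemma llr_withDensity_ofReal {α : Type*} [MeasurableSpace α] (μ : Measure α) [SigmaFinite μ]
    {f g : α → ℝ} (hf : Measurable f) (hg : Measurable g) (hf0 : ∀ x, 0 < f x)
    (hg0 : ∀ x, 0 < g x) :
    llr (μ.withDensity fun x => ENNReal.ofReal (f x)) (μ.withDensity fun x => ENNReal.ofReal (g x))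
      =ᵐ[μ.withDensity fun x => ENNReal.ofReal (f x)] fun x => Real.log (f x) - Real.log (g x) := by
  have hfg : Measurable fun x => ENNReal.ofReal (f x / g x) := (hf.div hg).ennreal_ofReal
  have hQ : μ.withDensity (fun x => ENNReal.ofReal (f x)) =
      (μ.withDensity fun x => ENNReal.ofReal (g x)).withDensity
        fun x => ENNReal.ofReal (f x / g x) := by
    rw [← withDensity_mul μ hg.ennreal_ofReal hfg]
    congr 1
    ext x
    rw [Pi.mul_apply, ← ENNReal.ofReal_mul (hg0 x).le, mul_div_cancel₀ _ (hg0 x).ne']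
  have h := Measure.rnDeriv_withDensity (μ.withDensity fun x => ENNReal.ofReal (g x)) hfg
  refine (withDensity_ofReal_absolutelyContinuous μ hg hg0).ae_le ?_
  filter_upwards [h] with x hx
  rw [llr, hQ, hx, ENNReal.toReal_ofReal (div_pos (hf0 x) (hg0 x)).le,
    Real.log_div (hf0 x).ne' (hg0 x).ne']

/-- The Kullback–Leibler divergence between two nondegenerate Gaussian measures. -/
lemma klDiv_mvGaussian {M : ℕ} (a b : Fin M → ℝ) {S K : Matrix (Fin M) (Fin M) ℝ}
    (hS : S.PosDef) (hK : K.PosDef) :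
    klDiv (mvGaussian b S) (mvGaussian a K) =
      ENNReal.ofReal ((1 / 2) * Real.log K.det - (1 / 2) * Real.log S.det - (M : ℝ) / 2
        + (1 / 2) * (K⁻¹ * S).trace + (1 / 2) * ((b - a) ⬝ᵥ K⁻¹ *ᵥ (b - a))) := by
  have hmeas : ∀ (c : Fin M → ℝ) (B : Matrix (Fin M) (Fin M) ℝ), Measurable fun x : Fin M → ℝ =>
      (2 * Real.pi) ^ (-(M : ℝ) / 2) * B.det ^ (-(1 : ℝ) / 2) *
        Real.exp (-(1 / 2) * ((x - c) ⬝ᵥ B⁻¹ *ᵥ (x - c))) := fun c B =>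
    Continuous.measurable (by fun_prop)
  have hpos : ∀ (c : Fin M → ℝ) {B : Matrix (Fin M) (Fin M) ℝ}, B.PosDef → ∀ x : Fin M → ℝ,
      0 < (2 * Real.pi) ^ (-(M : ℝ) / 2) * B.det ^ (-(1 : ℝ) / 2) *
        Real.exp (-(1 / 2) * ((x - c) ⬝ᵥ B⁻¹ *ᵥ (x - c))) := fun c B hB x => by
    have := hB.det_pos
    positivity
  have hlog : ∀ (c : Fin M → ℝ) {B : Matrix (Fin M) (Fin M) ℝ}, B.PosDef → ∀ x : Fin M → ℝ,
      Real.log ((2 * Real.pi) ^ (-(M : ℝ) / 2) * B.det ^ (-(1 : ℝ) / 2) *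
        Real.exp (-(1 / 2) * ((x - c) ⬝ᵥ B⁻¹ *ᵥ (x - c)))) =
      Real.log ((2 * Real.pi) ^ (-(M : ℝ) / 2)) - (1 / 2) * Real.log B.det -
        (1 / 2) * ((x - c) ⬝ᵥ B⁻¹ *ᵥ (x - c)) := fun c B hB x => by
    have hd := hB.det_pos
    rw [Real.log_mul (by positivity) (by positivity), Real.log_mul (by positivity) (by positivity),
      Real.log_exp, Real.log_rpow hd]
    ring
  have hac : mvGaussian b S ≪ mvGaussian a K :=
    withDensity_ofReal_absolutelyContinuous _ (hmeas a K) (hpos a hK)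
  have hllr : llr (mvGaussian b S) (mvGaussian a K) =ᵐ[mvGaussian b S] fun x =>
      ((1 / 2) * Real.log K.det - (1 / 2) * Real.log S.det) -
        (1 / 2) * ((x - b) ⬝ᵥ S⁻¹ *ᵥ (x - b)) + (1 / 2) * ((x - a) ⬝ᵥ K⁻¹ *ᵥ (x - a)) := by
    filter_upwards [llr_withDensity_ofReal volume (hmeas b S) (hmeas a K) (hpos b hS) (hpos a hK)]
      with x hx
    rw [mvGaussian, mvGaussian, hx, hlog b hS, hlog a hK]
    ring
  have := isProbabilityMeasure_mvGaussian b hS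
  have hb := (integrable_quadForm_mvGaussian b b hS S⁻¹).const_mul (1 / 2)
  have ha := (integrable_quadForm_mvGaussian b a hS K⁻¹).const_mul (1 / 2)
  have hc := integrable_const (μ := mvGaussian b S)
    ((1 / 2) * Real.log K.det - (1 / 2) * Real.log S.det)
  rw [klDiv, if_pos ⟨hac, (integrable_congr hllr).2 ((hc.sub hb).add ha)⟩, integral_congr_ae hllr,
    integral_add (by exact hc.sub hb) ha, integral_sub hc hb, integral_const, integral_const_mul,
    integral_const_mul, integral_quadForm_mvGaussian b b hS, integral_quadForm_mvGaussian b a hS,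
    nonsing_inv_mul _ hS.det_pos.ne'.isUnit]
  congr 1
  simp
  ring

/-- **KL divergence between the GP-regression posterior and prior marginals.**
With `Q = N(m + K(K+σ²I)⁻¹(y−m), K − K(K+σ²I)⁻¹K)` and `P = N(m,K)`,
`KL(Q‖P) = (1/2) ln det(K+σ²I) − (N/2) ln σ² − (1/2) tr(K(K+σ²I)⁻¹)
  + (1/2)(y−m)ᵀ(K+σ²I)⁻¹K(K+σ²I)⁻¹(y−m)`. -/
theorem klDiv_gp_posterior_prior
    (N : ℕ) (hN : 0 < N) (y m : Fin N → ℝ) (σn : ℝ) (hσn : 0 < σn)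
    (K : Matrix (Fin N) (Fin N) ℝ) (hK : K.PosDef) :
    klDiv
        (mvGaussian (m + K *ᵥ ((K + σn ^ 2 • (1 : Matrix (Fin N) (Fin N) ℝ))⁻¹ *ᵥ (y - m)))
          (K - K * (K + σn ^ 2 • (1 : Matrix (Fin N) (Fin N) ℝ))⁻¹ * K))
        (mvGaussian m K) =
      ENNReal.ofReal
        ((1 / 2) * Real.log (K + σn ^ 2 • (1 : Matrix (Fin N) (Fin N) ℝ)).det
          - (N : ℝ) / 2 * Real.log (σn ^ 2)
          - (1 / 2) * (K * (K + σn ^ 2 • (1 : Matrix (Fin N) (Fin N) ℝ))⁻¹).trace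
          + (1 / 2) * ((y - m) ⬝ᵥ
              ((K + σn ^ 2 • (1 : Matrix (Fin N) (Fin N) ℝ))⁻¹ * K *
                (K + σn ^ 2 • (1 : Matrix (Fin N) (Fin N) ℝ))⁻¹) *ᵥ (y - m))) := by
  set s : ℝ := σn ^ 2 with hs
  have hs0 : 0 < s := by positivity
  set L : Matrix (Fin N) (Fin N) ℝ := K + s • 1 with hL
  have hLpos : L.PosDef := hK.add (PosDef.one.smul hs0)
  have hKu : IsUnit K.det := hK.det_pos.ne'.isUnit
  have hLu : IsUnit L.det := hLpos.det_pos.ne'.isUnit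
  have hKL : K * L⁻¹ = 1 - s • L⁻¹ := by
    have h : K = L - s • 1 := by rw [hL, add_sub_cancel_right]
    calc K * L⁻¹ = (L - s • 1) * L⁻¹ := by rw [← h]
      _ = 1 - s • L⁻¹ := by rw [sub_mul, mul_nonsing_inv _ hLu, smul_mul_assoc, one_mul]
  have hcov : K - K * L⁻¹ * K = s • (L⁻¹ * K) := by
    rw [hKL, sub_mul, one_mul, smul_mul_assoc]
    exact sub_sub_cancel _ _
  have hcov_inv : (s⁻¹ • (1 : Matrix (Fin N) (Fin N) ℝ) + K⁻¹)⁻¹ = K - K * L⁻¹ * K := by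
    refine inv_eq_left_inv ?_
    rw [hcov, smul_mul_assoc, mul_assoc, mul_add, mul_nonsing_inv _ hKu, mul_smul_comm, mul_one,
      ← mul_smul_comm, smul_add, smul_smul, mul_inv_cancel₀ hs0.ne', one_smul, ← hL,
      nonsing_inv_mul _ hLu]
  have hcov_pos : (K - K * L⁻¹ * K).PosDef :=
    hcov_inv ▸ ((PosDef.one.smul (inv_pos.2 hs0)).add hK.inv).inv
  rw [klDiv_mvGaussian _ _ hcov_pos hK]
  congr 1
  have hdet : Real.log (K - K * L⁻¹ * K).det =
      N * Real.log s - Real.log L.det + Real.log K.det := by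
    rw [hcov, det_smul, det_mul, det_nonsing_inv, Ring.inverse_eq_inv', Fintype.card_fin,
      Real.log_mul (by positivity) (mul_ne_zero (inv_ne_zero hLu.ne_zero) hKu.ne_zero),
      Real.log_mul (inv_ne_zero hLu.ne_zero) hKu.ne_zero, Real.log_pow, Real.log_inv]
    ring
  have htrace : (K⁻¹ * (K - K * L⁻¹ * K)).trace = N - (K * L⁻¹).trace := by
    rw [mul_sub, nonsing_inv_mul _ hKu, mul_assoc, nonsing_inv_mul_cancel_left _ _ hKu, trace_sub,
      trace_one, Fintype.card_fin, trace_mul_comm L⁻¹]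
  have hKt : Kᵀ = K := by
    simpa [conjTranspose_eq_transpose_of_trivial] using hK.isHermitian.eq
  have hLt : L⁻¹ᵀ = L⁻¹ := by
    simpa [conjTranspose_eq_transpose_of_trivial] using hLpos.inv.isHermitian.eq
  have hquad : (m + K *ᵥ (L⁻¹ *ᵥ (y - m)) - m) ⬝ᵥ K⁻¹ *ᵥ (m + K *ᵥ (L⁻¹ *ᵥ (y - m)) - m) =
      (y - m) ⬝ᵥ (L⁻¹ * K * L⁻¹) *ᵥ (y - m) := by
    rw [add_sub_cancel_left, mulVec_mulVec _ K⁻¹, nonsing_inv_mul _ hKu, one_mulVec,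
      dotProduct_comm, mulVec_mulVec, ← hLt, mulVec_transpose, ← dotProduct_mulVec, hLt,
      mulVec_mulVec, mul_assoc]
  rw [hdet, htrace, hquad]
  ring
end
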